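/- arXiv:2111.07595 — 2 statements merged into one kernel-verified Lean document; each statement's English description precedes it below -/
import Mathlib

section
/- Let p be an odd prime and r a positive integer with p^r ≡ 3 (mod 4). Then the sum over k from 0 to p^r - 1 of (6k+1)·(1/2)_k^3·(1/4)_k / (k!^4 · 4^k) is congruent to 0 modulo p^(r+3). -/
/-- The rising factorial (Pochhammer symbol) `(x)_k = x(x+1)⋯(x+k-1)`. -/
def risingFac (x : ℚ) (k : ℕ) : ℚ := ∏ i ∈ Finset.range k, (x + i)

open Finset

lemma risingFac_succ (x : ℚ) (k : ℕ) : risingFac x (k + 1) = risingFac x k * (x + k) := by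
  simp [risingFac, prod_range_succ]

lemma risingFac_add (x : ℚ) (j n : ℕ) :
    risingFac x (j + n) = risingFac x j * risingFac (x + j) n := by
  simp [risingFac, prod_range_add, add_assoc]

lemma risingFac_ne_zero {x : ℚ} (hx : 0 < x) (k : ℕ) : risingFac x k ≠ 0 :=
  prod_ne_zero_iff.2 fun i _ => by positivity

lemma cast_descFactorial_succ (k m : ℕ) :
    (k.descFactorial (m + 1) : ℚ) = (k - m) * k.descFactorial m := by
  rcases le_or_gt m k with h | h
  · rw [Nat.descFactorial_succ, Nat.cast_mul, Nat.cast_sub h]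
  · simp [Nat.descFactorial_of_lt h]

/-- The summand, deformed by a parameter `j`; the original one is at `j = 0`. -/
def wzF (k j : ℕ) : ℚ :=
  (6 * k + 1) * risingFac (1/2) k ^ 3 * risingFac (1/4) (k + j) * k.descFactorial (2 * j) /
    ((k.factorial : ℚ) ^ 4 * 4 ^ (k + j) * risingFac (1/4) j ^ 3)

/-- The Wilf–Zeilberger companion of `wzF`. -/
def wzG (k j : ℕ) : ℚ :=
  -2 * k ^ 3 * risingFac (1/2) k ^ 3 * risingFac (1/4) (k + j) * k.descFactorial (2 * j + 1) /
    ((k.factorial : ℚ) ^ 4 * 4 ^ (k + j) * risingFac (1/4) (j + 1) ^ 3)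

lemma wzF_succ_sub_wzF (k j : ℕ) : wzF k (j + 1) - wzF k j = wzG (k + 1) j - wzG k j := by
  have he := risingFac_ne_zero (x := 1/4) (by norm_num) j
  have hk : (k.factorial : ℚ) ≠ 0 := by positivity
  have hj : (1 / 4 + j : ℚ) ≠ 0 := by positivity
  have hk1 : (k + 1 : ℚ) ≠ 0 := by positivity
  have h1 : k + 1 + j = k + j + 1 := by ring
  have h2 : 2 * (j + 1) = 2 * j + 1 + 1 := by ring
  simp only [wzF, wzG, ← add_assoc, h1, h2, risingFac_succ, Nat.succ_descFactorial_succ,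
    cast_descFactorial_succ, Nat.factorial_succ, pow_succ (4 : ℚ)]
  push_cast
  generalize risingFac (1/4) j = e at *
  generalize risingFac (1/4) (k + j) = b at *
  generalize risingFac (1/2) k = a at *
  generalize (k.descFactorial (2 * j) : ℚ) = D at *
  generalize (k.factorial : ℚ) = f at *
  field_simp
  ring

lemma sum_wzF_sub (n J : ℕ) :
    ∑ k ∈ range n, wzF k J - ∑ k ∈ range n, wzF k 0 = ∑ j ∈ range J, wzG n j := by
  have hG (j : ℕ) : wzG 0 j = 0 := by simp [wzG]
  rw [← sum_range_sub (fun j => ∑ k ∈ range n, wzF k j)]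
  refine sum_congr rfl fun j _ => ?_
  rw [← sum_sub_distrib, sum_congr rfl fun k _ => wzF_succ_sub_wzF k j,
    sum_range_sub (fun k => wzG k j), hG, sub_zero]

lemma sum_wzF_zero {n J : ℕ} (h : n ≤ 2 * J) :
    ∑ k ∈ range n, wzF k 0 = -∑ j ∈ range J, wzG n j := by
  rw [← sum_wzF_sub, sum_eq_zero (s := range n) (f := fun k => wzF k J), zero_sub, neg_neg]
  intro k hk
  have : k < 2 * J := (mem_range.1 hk).trans_le h
  simp [wzF, Nat.descFactorial_of_lt this]

section Padic

variable {p : ℕ} [Fact p.Prime]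

lemma padic_norm_natCast_le_of_dvd {a b : ℕ} (h : a ∣ b) : ‖(b : ℚ_[p])‖ ≤ ‖(a : ℚ_[p])‖ := by
  obtain ⟨c, rfl⟩ := h
  rw [Nat.cast_mul, norm_mul]
  exact mul_le_of_le_one_right (norm_nonneg _) (Padic.norm_int_le_one c)

lemma padic_norm_prod_arith_le {a : ℕ} (ha : a.Coprime p) (b n : ℕ) :
    ‖((∏ i ∈ range n, (a * i + b) : ℕ) : ℚ_[p])‖ ≤ ‖(n.factorial : ℚ_[p])‖ := by
  have hp : p.Prime := Fact.out
  obtain ⟨K, m, hm, hn⟩ := Nat.exists_eq_pow_mul_and_not_dvd n.factorial_ne_zero p hp.ne_one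
  have hnorm : ‖(n.factorial : ℚ_[p])‖ = ‖((p ^ K : ℕ) : ℚ_[p])‖ := by
    rw [hn, Nat.cast_mul, norm_mul, Padic.norm_natCast_eq_one_iff.2
      ((Nat.Prime.coprime_iff_not_dvd hp).2 hm), mul_one]
  rw [hnorm]
  apply padic_norm_natCast_le_of_dvd
  obtain ⟨c, hc⟩ : ∃ c : ℕ, a * c ≡ 1 [MOD p ^ K] := by
    have hu : IsUnit (a : ZMod (p ^ K)) :=
      (ZMod.isUnit_iff_coprime _ _).2 (Nat.Coprime.pow_right K ha)
    have : NeZero (p ^ K) := ⟨pow_ne_zero _ hp.ne_zero⟩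
    obtain ⟨u, hu⟩ := hu.exists_right_inv
    refine ⟨u.val, (ZMod.natCast_eq_natCast_iff _ _ _).1 ?_⟩
    simpa using hu
  have hmod : ∏ i ∈ range n, (a * i + b) ≡ ∏ i ∈ range n, a * (c * b + i) [MOD p ^ K] := by
    refine Nat.ModEq.prod fun i _ => ?_
    have := (hc.mul_right b).add_left (a * i)
    rw [one_mul] at this
    exact this.symm.trans (by rw [show a * i + a * c * b = a * (c * b + i) by ring])
  rw [hmod.dvd_iff dvd_rfl, prod_mul_distrib]
  refine Dvd.dvd.mul_left ?_ _
  rw [← Nat.ascFactorial_eq_prod_range]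
  exact (Dvd.intro _ hn.symm).trans (Nat.factorial_dvd_ascFactorial _ _)

lemma padic_norm_risingFac_eq {a : ℕ} (ha : a.Coprime p) (b n : ℕ) :
    ‖((risingFac (b / a) n : ℚ) : ℚ_[p])‖ =
      ‖((∏ i ∈ range n, (a * i + b) : ℕ) : ℚ_[p])‖ := by
  have hp : p.Prime := Fact.out
  have ha0 : a ≠ 0 := by
    rintro rfl
    exact hp.ne_one (by simpa using ha)
  have h : risingFac (b / a) n = ((∏ i ∈ range n, (a * i + b) : ℕ) : ℚ) / (a : ℚ) ^ n := by
    have ha0' : (a : ℚ) ≠ 0 := by exact_mod_cast ha0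
    rw [eq_div_iff (by positivity), risingFac, ← card_range n, ← prod_const, card_range,
      ← prod_mul_distrib]
    push_cast
    refine prod_congr rfl fun i _ => ?_
    field_simp
    ring
  rw [h, Rat.cast_div, Rat.cast_pow, norm_div, norm_pow, Rat.cast_natCast, Rat.cast_natCast,
    Padic.norm_natCast_eq_one_iff.2 ha.symm, one_pow, div_one]

lemma padic_norm_risingFac_le {a : ℕ} (ha : a.Coprime p) (b n : ℕ) :
    ‖((risingFac (b / a) n : ℚ) : ℚ_[p])‖ ≤ ‖(n.factorial : ℚ_[p])‖ :=
  (padic_norm_risingFac_eq ha b n).trans_le (padic_norm_prod_arith_le ha b n)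

lemma le_padic_norm_prod_arith {a : ℕ} (ha : a.Coprime p) (b j : ℕ) {ε : ℝ}
    (hε : ∀ l ≤ j, ε ≤ ‖((a * l + b : ℕ) : ℚ_[p])‖) :
    ‖(j.factorial : ℚ_[p])‖ * ε ≤ ‖((∏ i ∈ range (j + 1), (a * i + b) : ℕ) : ℚ_[p])‖ := by
  obtain ⟨l, hl, hmin⟩ := exists_min_image (range (j + 1))
    (fun l => ‖((a * l + b : ℕ) : ℚ_[p])‖) ⟨0, by simp⟩
  have hdiff (i : ℕ) (hi : i ∈ range (j + 1)) :
      ‖((i : ℚ_[p]) - l)‖ ≤ ‖((a * i + b : ℕ) : ℚ_[p])‖ := by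
    have h1 : ‖((a * i + b : ℕ) : ℚ_[p]) - ((a * l + b : ℕ) : ℚ_[p])‖ = ‖((i : ℚ_[p]) - l)‖ := by
      rw [← one_mul ‖(i : ℚ_[p]) - l‖, ← Padic.norm_natCast_eq_one_iff.2 ha.symm, ← norm_mul]
      push_cast
      ring_nf
    rw [← h1]
    rw [sub_eq_add_neg]
    refine (IsUltrametricDist.norm_add_le_max _ _).trans ?_
    rw [norm_neg]
    exact max_le le_rfl (hmin i hi)
  obtain ⟨m, rfl⟩ : ∃ m, j = l + m := Nat.exists_eq_add_of_le (by simpa [Nat.lt_succ_iff] using hl)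
  have hlow : ‖(l.factorial : ℚ_[p])‖ ≤ ∏ i ∈ range l, ‖((a * i + b : ℕ) : ℚ_[p])‖ := by
    rw [← Nat.descFactorial_self, Nat.descFactorial_eq_prod_range, Nat.cast_prod, norm_prod]
    refine prod_le_prod (fun _ _ => norm_nonneg _) fun i hi => ?_
    have hi := mem_range.1 hi
    rw [Nat.cast_sub hi.le, norm_sub_rev]
    exact hdiff i (mem_range.2 (by omega))
  have hhigh : ‖(m.factorial : ℚ_[p])‖ ≤
      ∏ i ∈ range m, ‖((a * (l + 1 + i) + b : ℕ) : ℚ_[p])‖ := by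
    rw [← prod_range_add_one_eq_factorial, Nat.cast_prod, norm_prod]
    refine prod_le_prod (fun _ _ => norm_nonneg _) fun i hi => ?_
    have hi := mem_range.1 hi
    refine le_trans (le_of_eq ?_) (hdiff (l + 1 + i) (mem_range.2 (by omega)))
    push_cast
    ring_nf
  have hfac : ‖((l + m).factorial : ℚ_[p])‖ ≤ ‖(l.factorial : ℚ_[p])‖ * ‖(m.factorial : ℚ_[p])‖ := by
    rw [← norm_mul, ← Nat.cast_mul]
    exact padic_norm_natCast_le_of_dvd (Nat.factorial_mul_factorial_dvd_factorial_add l m)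
  rw [Nat.cast_prod, norm_prod, show l + m + 1 = l + 1 + m by ring, prod_range_add,
    prod_range_succ]
  calc ‖((l + m).factorial : ℚ_[p])‖ * ε
      ≤ ‖((l + m).factorial : ℚ_[p])‖ * ‖((a * l + b : ℕ) : ℚ_[p])‖ := by
        gcongr
        exact hε l (by omega)
    _ ≤ (‖(l.factorial : ℚ_[p])‖ * ‖(m.factorial : ℚ_[p])‖) * ‖((a * l + b : ℕ) : ℚ_[p])‖ := by
        gcongr
    _ = ‖(l.factorial : ℚ_[p])‖ * ‖((a * l + b : ℕ) : ℚ_[p])‖ * ‖(m.factorial : ℚ_[p])‖ := by ring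
    _ ≤ _ := by gcongr

lemma padic_norm_wzG_le (hodd : Odd p) {r j : ℕ} (hr : 0 < r) (hp4 : p ^ r % 4 = 3)
    (hj : 2 * j + 1 ≤ p ^ r) :
    ‖((wzG (p ^ r) j : ℚ) : ℚ_[p])‖ ≤ (p : ℝ) ^ (-(r + 3 : ℤ)) := by
  have hp : p.Prime := Fact.out
  have hp0 : (0 : ℝ) < p := by exact_mod_cast hp.pos
  have h2 : Nat.Coprime 2 p := Nat.coprime_two_left.2 hodd
  have h4 : Nat.Coprime 4 p := by simpa using h2.pow_left 2
  have n2 : ‖(2 : ℚ_[p])‖ = 1 := by simpa using Padic.norm_natCast_eq_one_iff.2 h2.symm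
  have n4 : ‖(4 : ℚ_[p])‖ = 1 := by simpa using Padic.norm_natCast_eq_one_iff.2 h4.symm
  set x : ℝ := (p : ℝ)⁻¹
  have hx0 : 0 < x := by positivity
  have hlin : ∀ l ≤ j, x ^ (r - 1) ≤ ‖((4 * l + 1 : ℕ) : ℚ_[p])‖ := by
    intro l hl
    have hnd : ¬ p ^ r ∣ 4 * l + 1 := by
      rintro ⟨c, hc⟩
      have hc2 : c < 2 := by
        by_contra! h
        nlinarith
      interval_cases c <;> omega
    by_contra! h
    apply hnd
    have h' := (Padic.norm_le_pow_iff_norm_lt_pow_add_one (((4 * l + 1 : ℕ) : ℤ) : ℚ_[p])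
      (-r : ℤ)).2 (by
        rw [Int.cast_natCast, show (-r + 1 : ℤ) = -((r - 1 : ℕ) : ℤ) by omega, zpow_neg,
          zpow_natCast, ← inv_pow]
        exact h)
    exact_mod_cast (Padic.norm_int_le_pow_iff_dvd _ _).1 h'
  have hA : ‖(j.factorial : ℚ_[p])‖ * x ^ (r - 1) ≤
      ‖((risingFac (1/4) (j + 1) : ℚ) : ℚ_[p])‖ := by
    refine (le_padic_norm_prod_arith h4 1 j hlin).trans_eq ?_
    simpa using (padic_norm_risingFac_eq h4 1 (j + 1)).symm
  obtain ⟨s, rfl⟩ : ∃ s, r = s + 1 := Nat.exists_eq_add_of_lt hr |>.imp (by omega)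
  rw [Nat.add_sub_cancel] at hlin hA
  have hlam : x ^ s ≤ ‖(((1 / 4 + j : ℚ)) : ℚ_[p])‖ := by
    refine (hlin j le_rfl).trans_eq ?_
    have : (1 / 4 + j : ℚ) = ((4 * j + 1 : ℕ) : ℚ) / (4 : ℕ) := by
      push_cast
      ring
    rw [this, Rat.cast_div, norm_div, Rat.cast_natCast, Rat.cast_natCast,
      Padic.norm_natCast_eq_one_iff.2 h4.symm, div_one]
  have hN : ‖((p ^ (s + 1) : ℕ) : ℚ_[p])‖ = x ^ (s + 1) := by
    rw [Nat.cast_pow, norm_pow, Padic.norm_p]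
  have hD : ‖(((p ^ (s + 1)).descFactorial (2 * j + 1) : ℕ) : ℚ_[p])‖ ≤
      x ^ (s + 1) * ‖(j.factorial : ℚ_[p])‖ ^ 2 := by
    rw [← hN, ← norm_pow, ← Nat.cast_pow, ← norm_mul, ← Nat.cast_mul]
    apply padic_norm_natCast_le_of_dvd
    obtain ⟨m, hm⟩ : ∃ m, p ^ (s + 1) = m + 1 := Nat.exists_eq_succ_of_ne_zero (by omega)
    rw [hm, Nat.succ_descFactorial_succ]
    refine mul_dvd_mul_left _ (Dvd.dvd.trans ?_ (Nat.factorial_dvd_descFactorial _ _))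
    rw [pow_two, two_mul]
    exact Nat.factorial_mul_factorial_dvd_factorial_add j j
  generalize p ^ (s + 1) = n at *
  have hα : ‖((risingFac (1/2) n : ℚ) : ℚ_[p])‖ ≤ ‖(n.factorial : ℚ_[p])‖ := by
    simpa using padic_norm_risingFac_le h2 1 n
  have hβ : ‖((risingFac (1/4 + j) n : ℚ) : ℚ_[p])‖ ≤ ‖(n.factorial : ℚ_[p])‖ := by
    have : (1 / 4 + j : ℚ) = ((4 * j + 1 : ℕ) : ℚ) / (4 : ℕ) := by
      push_cast
      ring
    rw [this]
    exact padic_norm_risingFac_le h4 _ n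
  have hf : 0 < ‖(n.factorial : ℚ_[p])‖ := by
    rw [norm_pos_iff]
    exact_mod_cast n.factorial_ne_zero
  have he : 0 < ‖((risingFac (1/4) j : ℚ) : ℚ_[p])‖ := by
    rw [norm_pos_iff]
    exact_mod_cast risingFac_ne_zero (by norm_num) j
  have hx' : (p : ℝ) ^ (-((s + 1 : ℕ) + 3 : ℤ)) = x ^ (s + 4) := by
    rw [show (-((s + 1 : ℕ) + 3 : ℤ)) = -((s + 4 : ℕ) : ℤ) by push_cast; ring, zpow_neg,
      zpow_natCast, ← inv_pow]
  rw [hx', wzG, add_comm n j, risingFac_add]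
  rw [risingFac_succ, Rat.cast_mul, norm_mul] at hA
  rw [risingFac_succ]
  simp only [Rat.cast_div, Rat.cast_mul, Rat.cast_pow, Rat.cast_neg, Rat.cast_natCast,
    Rat.cast_ofNat, norm_div, norm_mul, norm_pow, norm_neg, n2, n4, one_pow, one_mul, mul_one, hN]
  have hl : 0 < ‖((1 / 4 + j : ℚ) : ℚ_[p])‖ := (pow_pos hx0 s).trans_le hlam
  generalize ‖((1 / 4 + j : ℚ) : ℚ_[p])‖ = l at *
  generalize ‖((risingFac (1/4) j : ℚ) : ℚ_[p])‖ = e at *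
  generalize ‖(n.factorial : ℚ_[p])‖ = f at *
  rw [div_le_iff₀ (by positivity)]
  calc _ ≤ (x ^ (s + 1)) ^ 3 * f ^ 3 * (e * f) * (x ^ (s + 1) * ‖(j.factorial : ℚ_[p])‖ ^ 2) := by
        gcongr
    _ = x ^ (s + 4) * (f ^ 4 * (e * x ^ s * (‖(j.factorial : ℚ_[p])‖ * x ^ s) ^ 2)) := by ring
    _ ≤ x ^ (s + 4) * (f ^ 4 * (e * l * (e * l) ^ 2)) := by gcongr
    _ = _ := by ring

end Padic

theorem stmt_1 (p : ℕ) [Fact p.Prime] (hodd : Odd p) (r : ℕ) (hr : 0 < r)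
    (hp4 : p ^ r % 4 = 3) :
    ‖((∑ k ∈ Finset.range (p ^ r),
        (6 * k + 1 : ℚ) * risingFac (1/2) k ^ 3 * risingFac (1/4) k /
          ((k.factorial : ℚ) ^ 4 * 4 ^ k) : ℚ) : ℚ_[p])‖ ≤ (p : ℝ) ^ (-(r + 3 : ℤ)) := by
  have hsum : ∑ k ∈ range (p ^ r), (6 * k + 1 : ℚ) * risingFac (1/2) k ^ 3 * risingFac (1/4) k /
      ((k.factorial : ℚ) ^ 4 * 4 ^ k) = ∑ k ∈ range (p ^ r), wzF k 0 :=
    sum_congr rfl fun k _ => by simp [wzF, risingFac]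
  rw [hsum, sum_wzF_zero (J := (p ^ r + 1) / 2) (by omega), Rat.cast_neg, norm_neg, Rat.cast_sum]
  refine IsUltrametricDist.norm_sum_le_of_forall_le_of_nonneg (by positivity) fun j hj => ?_
  have hj := mem_range.1 hj
  exact padic_norm_wzG_le hodd hr hp4 (by omega)
end

section
/- Let p be an odd prime and r a positive integer with p^r ≡ 3 (mod 4). Then the sum over k from 0 to p^r - 1 of (6k+1)·(1/2)_k^3·(1/4)_k^2 / k!^5 is congruent to (3p^r/4)·((1/2)_{(3p^r-1)/4})^2 / ((1)_{(3p^r-1)/4})^2 modulo p^(r+4). -/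
section Identities

variable {K : Type*} [Field K]

/-- The summand without its linear factor, with parameters `b = 1/2 + x`, `d = 1/2 + y`
where `z = x ^ 2` and `Y = y ^ 2`. -/
def deformedTerm (z Y : K) (k : ℕ) : K :=
  ∏ i ∈ Finset.range k, ((i + 1 / 2) * ((i + 1 / 2) ^ 2 - z) * ((i + 1 / 4) ^ 2 - Y / 4) /
    ((i + 1) * ((i + 1) ^ 2 - z / 4) * ((i + 1) ^ 2 - Y)))

/-- The truncated deformed sum. -/
def deformedSum (z Y : K) (n : ℕ) : K :=
  ∑ k ∈ Finset.range n, (6 * k + 1) * deformedTerm z Y k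

/-- The value `Y = (2 N + 1 / 2) ^ 2` at which the deformed sum terminates after `N + 1` terms. -/
def node (K : Type*) [Field K] (N : ℕ) : K := (2 * N + 1 / 2) ^ 2

/-- The value of the deformed sum at `node K N`. -/
def nodeValue (z : K) (N : ℕ) : K :=
  (4 * N + 1) * ∏ i ∈ Finset.range N, (((i + 1 / 2) ^ 2 - z / 4) / ((i + 1) ^ 2 - z / 4))

variable [CharZero K]

lemma intCast_ne_zero_of_odd {m : ℤ} (hm : m % 2 = 1) : (m : K) ≠ 0 := by
  exact_mod_cast (by omega : m ≠ 0)

omit [CharZero K] in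
lemma deformedTerm_succ (z Y : K) (k : ℕ) :
    deformedTerm z Y (k + 1) = deformedTerm z Y k *
      ((k + 1 / 2) * ((k + 1 / 2) ^ 2 - z) * ((k + 1 / 4) ^ 2 - Y / 4) /
        ((k + 1) * ((k + 1) ^ 2 - z / 4) * ((k + 1) ^ 2 - Y))) :=
  Finset.prod_range_succ _ _

lemma deformedTerm_node (z : K) (hz : ∀ i : ℕ, ((i : K) + 1) ^ 2 - z / 4 ≠ 0) (N k : ℕ) :
    deformedTerm z (node K N) k = deformedTerm z (node K (N + 1)) k *
      ((N + 1 - k) * (2 * N + 1) * (4 * N + 1) * (2 * k + 4 * N + 3) * (2 * k + 4 * N + 5) /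
        ((N + 1) * (4 * N + 5) * (2 * N + 1 + 2 * k) * (2 * k - 4 * N - 3) *
          (2 * k - 4 * N - 1))) := by
  have e1 : (N : K) + 1 ≠ 0 := by exact_mod_cast N.succ_ne_zero
  have e2 : 4 * (N : K) + 5 ≠ 0 := by exact_mod_cast (by omega : 4 * N + 5 ≠ 0)
  have e2' : 4 * (N : K) + 1 ≠ 0 := by exact_mod_cast (by omega : 4 * N + 1 ≠ 0)
  have e2'' : 2 * (N : K) + 1 ≠ 0 := by exact_mod_cast (by omega : 2 * N + 1 ≠ 0)
  have e3 (j : ℕ) : 2 * (N : K) + 1 + 2 * j ≠ 0 := by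
    exact_mod_cast (by omega : 2 * N + 1 + 2 * j ≠ 0)
  have e4 (j : ℕ) : 2 * (j : K) - 4 * N - 3 ≠ 0 := by
    exact_mod_cast intCast_ne_zero_of_odd (K := K) (m := 2 * j - 4 * N - 3) (by omega)
  have e5 (j : ℕ) : 2 * (j : K) - 4 * N - 1 ≠ 0 := by
    exact_mod_cast intCast_ne_zero_of_odd (K := K) (m := 2 * j - 4 * N - 1) (by omega)
  have e6 (j : ℕ) : 2 * (j : K) + 4 * N + 3 ≠ 0 := by
    exact_mod_cast (by omega : 2 * j + 4 * N + 3 ≠ 0)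
  have e7 (j : ℕ) : 2 * (j : K) + 4 * N + 5 ≠ 0 := by
    exact_mod_cast (by omega : 2 * j + 4 * N + 5 ≠ 0)
  have e8 (j : ℕ) : 2 * (j : K) + 4 * N + 7 ≠ 0 := by
    exact_mod_cast (by omega : 2 * j + 4 * N + 7 ≠ 0)
  induction k with
  | zero =>
    have := e3 0; have := e4 0; have := e5 0
    simp only [deformedTerm, Finset.range_zero, Finset.prod_empty, Nat.cast_zero] at *
    rw [one_mul, eq_div_iff (by simp_all)]
    ring
  | succ k ih =>
    have f1 : ((k : K) + 1 / 4) ^ 2 - node K N / 4 = (k - N) * (2 * N + 1 + 2 * k) / 2 := by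
      simp only [node]; ring
    have f2 : ((k : K) + 1 / 4) ^ 2 - node K (N + 1) / 4 =
        (k - N - 1) * (2 * N + 1 + 2 * (k + 1 : ℕ)) / 2 := by
      simp only [node]; push_cast; ring
    have f3 : ((k : K) + 1) ^ 2 - node K N =
        (2 * (k + 1 : ℕ) - 4 * N - 1) * (2 * k + 4 * N + 3) / 4 := by
      simp only [node]; push_cast; ring
    have f4 : ((k : K) + 1) ^ 2 - node K (N + 1) =
        (2 * k - 4 * N - 3) * (2 * (k + 1 : ℕ) + 4 * N + 5) / 4 := by
      simp only [node]; push_cast; ring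
    have g0 : (k : K) + 1 ≠ 0 := by exact_mod_cast k.succ_ne_zero
    have := hz k
    have := e3 k; have := e3 (k + 1); have := e4 k; have := e5 k; have := e4 (k + 1)
    have := e5 (k + 1); have := e6 k; have := e7 k; have := e7 (k + 1)
    rw [deformedTerm_succ, deformedTerm_succ, ih, f1, f2, f3, f4]
    have h1 : (N : K) + 1 - k = -(k - N - 1) := by ring
    have h2 : (N : K) + 1 - (k + 1 : ℕ) = -(k - N) := by push_cast; ring
    have h5 : 2 * ((k + 1 : ℕ) : K) - 4 * N - 3 = 2 * k - 4 * N - 1 := by push_cast; ring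
    have h7 : 2 * ((k + 1 : ℕ) : K) + 4 * N + 3 = 2 * k + 4 * N + 5 := by push_cast; ring
    rw [h1, h2, h5, h7]
    generalize deformedTerm z (node K (N + 1)) k = U
    generalize ((k : K) + 1) ^ 2 - z / 4 = W at *
    generalize ((k : K) + 1 / 2) ^ 2 - z = V at *
    generalize (k : K) + 1 / 2 = a1 at *
    generalize (k : K) + 1 = a2 at *
    generalize (k : K) - N - 1 = a3 at *
    generalize (k : K) - N = a4 at *
    generalize 2 * (N : K) + 1 + 2 * k = b1 at *
    generalize 2 * (N : K) + 1 + 2 * (k + 1 : ℕ) = b2 at *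
    generalize 2 * (k : K) - 4 * N - 3 = c1 at *
    generalize 2 * (k : K) - 4 * N - 1 = c2 at *
    generalize 2 * ((k + 1 : ℕ) : K) - 4 * N - 1 = c3 at *
    generalize 2 * (k : K) + 4 * N + 3 = d1 at *
    generalize 2 * (k : K) + 4 * N + 5 = d2 at *
    generalize 2 * ((k + 1 : ℕ) : K) + 4 * N + 5 = d3 at *
    generalize 2 * (N : K) + 1 = s1 at *
    generalize 4 * (N : K) + 1 = s2 at *
    generalize 4 * (N : K) + 5 = s3 at *
    generalize (N : K) + 1 = s4 at *
    clear e3 e4 e5 e6 e7 e8 f1 f2 f3 f4 h1 h2 h5 h7 hz ih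
    field_simp

lemma sum_deformedTerm_node_succ (z : K) (hz : ∀ i : ℕ, ((i : K) + 1) ^ 2 - z / 4 ≠ 0)
    (N m : ℕ) :
    ∑ k ∈ Finset.range m, (6 * (k : K) + 1) * (deformedTerm z (node K (N + 1)) k -
      (4 * N + 5) / (4 * N + 1) * (((N + 1 / 2) ^ 2 - z / 4) / ((N + 1) ^ 2 - z / 4)) *
        deformedTerm z (node K N) k) =
    (4 * N + 3) / ((N + 1) * ((N + 1) ^ 2 - z / 4)) *
      (m * (m ^ 2 - z / 4) * (2 * m - 1) * (2 * m + 4 * N + 5) /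
        ((2 * m - 4 * N - 3) * (2 * N + 1 + 2 * m))) * deformedTerm z (node K (N + 1)) m := by
  have e1 : (N : K) + 1 ≠ 0 := by exact_mod_cast N.succ_ne_zero
  have e2 : 4 * (N : K) + 5 ≠ 0 := by exact_mod_cast (by omega : 4 * N + 5 ≠ 0)
  have e2' : 4 * (N : K) + 1 ≠ 0 := by exact_mod_cast (by omega : 4 * N + 1 ≠ 0)
  induction m with
  | zero => simp
  | succ k ih =>
    have c1 : 2 * (k : K) - 4 * N - 3 ≠ 0 := by
      exact_mod_cast intCast_ne_zero_of_odd (K := K) (m := 2 * k - 4 * N - 3) (by omega)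
    have c2 : 2 * (k : K) - 4 * N - 1 ≠ 0 := by
      exact_mod_cast intCast_ne_zero_of_odd (K := K) (m := 2 * k - 4 * N - 1) (by omega)
    have b1 : 2 * (N : K) + 1 + 2 * k ≠ 0 := by
      exact_mod_cast (by omega : 2 * N + 1 + 2 * k ≠ 0)
    have b2 : 2 * (N : K) + 3 + 2 * k ≠ 0 := by
      exact_mod_cast (by omega : 2 * N + 3 + 2 * k ≠ 0)
    have d3 : 2 * (k : K) + 4 * N + 7 ≠ 0 := by
      exact_mod_cast (by omega : 2 * k + 4 * N + 7 ≠ 0)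
    have a2 : (k : K) + 1 ≠ 0 := by exact_mod_cast k.succ_ne_zero
    have w1 := hz k
    have w2 := hz N
    have f2 : ((k : K) + 1 / 4) ^ 2 - node K (N + 1) / 4 =
        (k - N - 1) * (2 * N + 3 + 2 * k) / 2 := by
      simp only [node]; push_cast; ring
    have f4 : ((k : K) + 1) ^ 2 - node K (N + 1) =
        (2 * k - 4 * N - 3) * (2 * k + 4 * N + 7) / 4 := by
      simp only [node]; push_cast; ring
    have key : (((k + 1 : ℕ) : K) * (((k + 1 : ℕ) : K) ^ 2 - z / 4) * (2 * ((k + 1 : ℕ) : K) - 1) *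
          (2 * ((k + 1 : ℕ) : K) + 4 * N + 5) /
          ((2 * ((k + 1 : ℕ) : K) - 4 * N - 3) * (2 * N + 1 + 2 * ((k + 1 : ℕ) : K)))) *
        ((k + 1 / 2) * ((k + 1 / 2) ^ 2 - z) * ((k + 1 / 4) ^ 2 - node K (N + 1) / 4) /
        ((k + 1) * ((k + 1) ^ 2 - z / 4) * ((k + 1) ^ 2 - node K (N + 1)))) =
        (2 * k + 1) ^ 2 * ((k + 1 / 2) ^ 2 - z) * (k - N - 1) /
          ((2 * k - 4 * N - 1) * (2 * k - 4 * N - 3)) := by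
      have h1 : 2 * ((k + 1 : ℕ) : K) - 4 * N - 3 = 2 * k - 4 * N - 1 := by push_cast; ring
      have h2 : 2 * (N : K) + 1 + 2 * ((k + 1 : ℕ) : K) = 2 * N + 3 + 2 * k := by push_cast; ring
      have h3 : 2 * ((k + 1 : ℕ) : K) + 4 * N + 5 = 2 * k + 4 * N + 7 := by push_cast; ring
      have h4 : (k : K) + 1 / 2 = (2 * k + 1) / 2 := by ring
      have h5 : 2 * ((k + 1 : ℕ) : K) - 1 = 2 * k + 1 := by push_cast; ring
      rw [f2, f4, h1, h2, h3, h5, h4, Nat.cast_succ]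
      generalize ((k : K) + 1) ^ 2 - z / 4 = W at *
      generalize ((2 * (k : K) + 1) / 2) ^ 2 - z = V at *
      generalize 2 * (k : K) + 1 = a1 at *
      generalize (k : K) + 1 = a2 at *
      generalize (k : K) - N - 1 = a3 at *
      generalize 2 * (N : K) + 3 + 2 * k = b2 at *
      generalize 2 * (k : K) - 4 * N - 3 = c1 at *
      generalize 2 * (k : K) - 4 * N - 1 = c2 at *
      generalize 2 * (k : K) + 4 * N + 7 = d3 at *
      clear f2 f4 h1 h2 h3 h4 h5 hz ih
      field_simp
      ring
    have swap (a b c d : K) : a * b * (c * d) = c * a * (b * d) := by ring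
    rw [Finset.sum_range_succ, ih, deformedTerm_succ,
      swap _ _ (deformedTerm z (node K (N + 1)) k), key, deformedTerm_node z hz N k]
    clear key f2 f4 ih hz
    generalize deformedTerm z (node K (N + 1)) k = U
    generalize hW : ((N : K) + 1) ^ 2 - z / 4 = W at *
    generalize hs1 : (N : K) + 1 = s1 at *
    generalize hs2 : 4 * (N : K) + 5 = s2 at *
    generalize hs3 : 4 * (N : K) + 1 = s3 at *
    generalize hb1 : 2 * (N : K) + 1 + 2 * k = b1' at *
    generalize hc1 : 2 * (k : K) - 4 * N - 3 = c1' at *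
    generalize hc2 : 2 * (k : K) - 4 * N - 1 = c2' at *
    field_simp
    subst hW hs1 hs2 hs3 hb1 hc1 hc2
    ring
lemma deformedTerm_node_eq_zero (z : K) {N k : ℕ} (h : N < k) :
    deformedTerm z (node K N) k = 0 := by
  refine Finset.prod_eq_zero (Finset.mem_range.2 h) ?_
  rw [show ((N : K) + 1 / 4) ^ 2 - node K N / 4 = 0 by simp only [node]; ring]
  simp

lemma deformedSum_node (z : K) (hz : ∀ i : ℕ, ((i : K) + 1) ^ 2 - z / 4 ≠ 0) {N n : ℕ}
    (h : N < n) : deformedSum z (node K N) n = nodeValue z N := by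
  induction N with
  | zero =>
    rw [deformedSum, Finset.sum_eq_single_of_mem 0 (Finset.mem_range.2 h)
      fun k _ hk => by rw [deformedTerm_node_eq_zero z (Nat.pos_of_ne_zero hk), mul_zero]]
    simp [deformedTerm, nodeValue]
  | succ N ih =>
    have key := sum_deformedTerm_node_succ z hz N n
    rw [deformedTerm_node_eq_zero z h, mul_zero] at key
    simp only [mul_sub, Finset.sum_sub_distrib, mul_left_comm _ (_ * _ : K), ← Finset.mul_sum]
      at key
    have e : 4 * (N : K) + 1 ≠ 0 := by exact_mod_cast (by omega : 4 * N + 1 ≠ 0)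
    rw [← deformedSum, ← deformedSum, ih (by omega), sub_eq_zero] at key
    rw [key, nodeValue, nodeValue, Finset.prod_range_succ]
    push_cast
    field_simp
    ring

lemma deformedTerm_odd (N k : ℕ) :
    deformedTerm ((2 * N + 3 / 2) ^ 2 : K) 0 k = deformedTerm ((2 * (N + 1) + 3 / 2) ^ 2 : K) 0 k *
      (-((k - 3 - 2 * N) * (k - 2 - 2 * N) * (4 * N + 3) * (4 * k + 4 * N + 7)) /
        ((k + 2 + 2 * N) * (k + 3 + 2 * N) * (4 * k - 4 * N - 3) * (4 * N + 7))) := by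
  have e2 : 4 * (N : K) + 7 ≠ 0 := by exact_mod_cast (by omega : 4 * N + 7 ≠ 0)
  have e3 : 4 * (N : K) + 3 ≠ 0 := by exact_mod_cast (by omega : 4 * N + 3 ≠ 0)
  have hb (j l : ℕ) : (j : K) + (l + 2 : ℕ) + 2 * N ≠ 0 := by
    exact_mod_cast (by omega : j + (l + 2) + 2 * N ≠ 0)
  have hc (j : ℕ) : 4 * (j : K) - 4 * N - 3 ≠ 0 := by
    exact_mod_cast intCast_ne_zero_of_odd (K := K) (m := 4 * j - 4 * N - 3) (by omega)
  have hd (j : ℕ) : 4 * (j : K) + 4 * N + 7 ≠ 0 := by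
    exact_mod_cast (by omega : 4 * j + 4 * N + 7 ≠ 0)
  induction k with
  | zero =>
    have h1 := hb 0 0; have h2 := hb 0 1; have h3 := hc 0
    push_cast at h1 h2 h3
    simp only [deformedTerm, Finset.range_zero, Finset.prod_empty, Nat.cast_zero]
    rw [one_mul, eq_div_iff (by norm_num at *; tauto)]
    ring
  | succ k ih =>
    have f1 : ((k : K) + 1 / 2) ^ 2 - (2 * N + 3 / 2) ^ 2 = (k - 1 - 2 * N) * (k + 2 + 2 * N) := by
      ring
    have f2 : ((k : K) + 1 / 2) ^ 2 - (2 * (N + 1) + 3 / 2) ^ 2 =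
        (k - 3 - 2 * N) * (k + 4 + 2 * N) := by ring
    have f3 : ((k : K) + 1) ^ 2 - (2 * N + 3 / 2) ^ 2 / 4 =
        (4 * k - 4 * N + 1) * (4 * k + 4 * N + 7) / 16 := by ring
    have f4 : ((k : K) + 1) ^ 2 - (2 * (N + 1) + 3 / 2) ^ 2 / 4 =
        (4 * k - 4 * N - 3) * (4 * k + 4 * N + 11) / 16 := by ring
    have b1 := hb k 0; have b2 := hb k 1; have b3 := hb k 2
    have c1 := hc k; have c2 := hc (k + 1); have d1 := hd k; have d2 := hd (k + 1)
    have h1 : ((k + 1 : ℕ) : K) - 3 - 2 * N = k - 2 - 2 * N := by push_cast; ring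
    have h2 : ((k + 1 : ℕ) : K) - 2 - 2 * N = k - 1 - 2 * N := by push_cast; ring
    have h3 : ((k + 1 : ℕ) : K) + 2 + 2 * N = k + 3 + 2 * N := by push_cast; ring
    have h4 : ((k + 1 : ℕ) : K) + 3 + 2 * N = k + 4 + 2 * N := by push_cast; ring
    have h5 : 4 * ((k + 1 : ℕ) : K) - 4 * N - 3 = 4 * k - 4 * N + 1 := by push_cast; ring
    have h6 : 4 * ((k + 1 : ℕ) : K) + 4 * N + 7 = 4 * k + 4 * N + 11 := by push_cast; ring
    have a2 : (k : K) + 1 ≠ 0 := by exact_mod_cast k.succ_ne_zero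
    rw [h5] at c2
    rw [h6] at d2
    norm_num only [Nat.cast_ofNat] at b1 b2 b3
    rw [deformedTerm_succ, deformedTerm_succ, ih, f1, f2, f3, f4, h1, h2, h3, h4, h5, h6,
      zero_div, sub_zero, sub_zero]
    generalize deformedTerm ((2 * (N + 1) + 3 / 2) ^ 2 : K) 0 k = U
    generalize (k : K) + 1 / 2 = a1 at *
    generalize (k : K) + 1 / 4 = a4 at *
    generalize (k : K) + 1 = a2 at *
    generalize (k : K) - 3 - 2 * N = a3 at *
    generalize (k : K) - 2 - 2 * N = a5 at *
    generalize (k : K) - 1 - 2 * N = a6 at *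
    generalize (k : K) + 2 + 2 * N = b1 at *
    generalize (k : K) + 3 + 2 * N = b2 at *
    generalize (k : K) + 4 + 2 * N = b3 at *
    generalize 4 * (k : K) - 4 * N - 3 = c1 at *
    generalize 4 * (k : K) - 4 * N + 1 = c2 at *
    generalize 4 * (k : K) + 4 * N + 7 = d1 at *
    generalize 4 * (k : K) + 4 * N + 11 = d2 at *
    generalize 4 * (N : K) + 3 = s1 at *
    generalize 4 * (N : K) + 7 = s2 at *
    clear hb hc hd f1 f2 f3 f4 h1 h2 h3 h4 h5 h6 ih
    field_simp

lemma sum_deformedTerm_odd_succ (N m : ℕ) :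
    ∑ k ∈ Finset.range m, (6 * (k : K) + 1) * (deformedTerm ((2 * (N + 1) + 3 / 2) ^ 2 : K) 0 k -
      ((2 * N + 2) / (2 * N + 3)) ^ 2 * ((4 * N + 7) / (4 * N + 3)) *
        deformedTerm ((2 * N + 3 / 2) ^ 2 : K) 0 k) =
    -2 / (2 * N + 3) ^ 2 * (m ^ 3 * (2 * m - 1) * (4 * m + 4 * N + 7) /
        ((m + 2 + 2 * N) * (m + 3 + 2 * N))) * deformedTerm ((2 * (N + 1) + 3 / 2) ^ 2 : K) 0 m := by
  have e1 : 2 * (N : K) + 3 ≠ 0 := by exact_mod_cast (by omega : 2 * N + 3 ≠ 0)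
  have e2 : 4 * (N : K) + 7 ≠ 0 := by exact_mod_cast (by omega : 4 * N + 7 ≠ 0)
  have e3 : 4 * (N : K) + 3 ≠ 0 := by exact_mod_cast (by omega : 4 * N + 3 ≠ 0)
  induction m with
  | zero => simp
  | succ k ih =>
    have b1 : (k : K) + 2 + 2 * N ≠ 0 := by exact_mod_cast (by omega : k + 2 + 2 * N ≠ 0)
    have b2 : (k : K) + 3 + 2 * N ≠ 0 := by exact_mod_cast (by omega : k + 3 + 2 * N ≠ 0)
    have b3 : (k : K) + 4 + 2 * N ≠ 0 := by exact_mod_cast (by omega : k + 4 + 2 * N ≠ 0)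
    have c1 : 4 * (k : K) - 4 * N - 3 ≠ 0 := by
      exact_mod_cast intCast_ne_zero_of_odd (K := K) (m := 4 * k - 4 * N - 3) (by omega)
    have d1 : 4 * (k : K) + 4 * N + 11 ≠ 0 := by
      exact_mod_cast (by omega : 4 * k + 4 * N + 11 ≠ 0)
    have a2 : (k : K) + 1 ≠ 0 := by exact_mod_cast k.succ_ne_zero
    have f2 : ((k : K) + 1 / 2) ^ 2 - (2 * (N + 1) + 3 / 2) ^ 2 =
        (k - 3 - 2 * N) * (k + 4 + 2 * N) := by ring
    have f4 : ((k : K) + 1) ^ 2 - (2 * (N + 1) + 3 / 2) ^ 2 / 4 =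
        (4 * k - 4 * N - 3) * (4 * k + 4 * N + 11) / 16 := by ring
    have key : (((k + 1 : ℕ) : K) ^ 3 * (2 * ((k + 1 : ℕ) : K) - 1) *
          (4 * ((k + 1 : ℕ) : K) + 4 * N + 7) /
          ((((k + 1 : ℕ) : K) + 2 + 2 * N) * (((k + 1 : ℕ) : K) + 3 + 2 * N))) *
        ((k + 1 / 2) * (((k : K) + 1 / 2) ^ 2 - (2 * (N + 1) + 3 / 2) ^ 2) *
          ((k + 1 / 4) ^ 2 - 0 / 4) /
        ((k + 1) * (((k : K) + 1) ^ 2 - (2 * (N + 1) + 3 / 2) ^ 2 / 4) * ((k + 1) ^ 2 - 0))) =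
        (2 * k + 1) ^ 2 * (4 * k + 1) ^ 2 * (k - 3 - 2 * N) /
          (2 * (k + 3 + 2 * N) * (4 * k - 4 * N - 3)) := by
      have h1 : ((k + 1 : ℕ) : K) + 2 + 2 * N = k + 3 + 2 * N := by push_cast; ring
      have h2 : ((k + 1 : ℕ) : K) + 3 + 2 * N = k + 4 + 2 * N := by push_cast; ring
      have h3 : 4 * ((k + 1 : ℕ) : K) + 4 * N + 7 = 4 * k + 4 * N + 11 := by push_cast; ring
      have h4 : (k : K) + 1 / 2 = (2 * k + 1) / 2 := by ring
      have h5 : 2 * ((k + 1 : ℕ) : K) - 1 = 2 * k + 1 := by push_cast; ring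
      have h6 : (k : K) + 1 / 4 = (4 * k + 1) / 4 := by ring
      rw [f2, f4, h1, h2, h3, h5, h4, h6, Nat.cast_succ, zero_div, sub_zero, sub_zero]
      generalize 2 * (k : K) + 1 = a1 at *
      generalize 4 * (k : K) + 1 = a4 at *
      generalize (k : K) + 1 = a2 at *
      generalize (k : K) - 3 - 2 * N = a3 at *
      generalize (k : K) + 3 + 2 * N = b2 at *
      generalize (k : K) + 4 + 2 * N = b3 at *
      generalize 4 * (k : K) - 4 * N - 3 = c1 at *
      generalize 4 * (k : K) + 4 * N + 11 = d1 at *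
      clear f2 f4 h1 h2 h3 h4 h5 h6 ih
      field_simp
      ring
    have swap (a b c d : K) : a * b * (c * d) = c * a * (b * d) := by ring
    rw [Finset.sum_range_succ, ih, deformedTerm_succ,
      swap _ _ (deformedTerm ((2 * (N + 1) + 3 / 2) ^ 2 : K) 0 k), key,
      deformedTerm_odd N k]
    clear key f2 f4 ih
    generalize deformedTerm ((2 * (N + 1) + 3 / 2) ^ 2 : K) 0 k = U
    generalize hs1 : 2 * (N : K) + 3 = s1 at *
    generalize hs2 : 4 * (N : K) + 7 = s2 at *
    generalize hs3 : 4 * (N : K) + 3 = s3 at *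
    generalize hb1 : (k : K) + 2 + 2 * N = b1' at *
    generalize hb2 : (k : K) + 3 + 2 * N = b2' at *
    generalize hc1 : 4 * (k : K) - 4 * N - 3 = c1' at *
    field_simp
    subst hs1 hs2 hs3 hb1 hb2 hc1
    ring

lemma deformedSum_odd (N n : ℕ) (h : 2 * N + 1 < n) :
    deformedSum ((2 * N + 3 / 2) ^ 2 : K) 0 n = 0 := by
  induction N with
  | zero =>
    rw [deformedSum, ← Finset.sum_subset (Finset.range_subset_range.2 (h : 2 ≤ n)) fun k _ hk => ?_]
    · simp [Finset.sum_range_succ, deformedTerm]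
      norm_num
    · rw [deformedTerm, Finset.prod_eq_zero (i := 1) (by simp at hk ⊢; omega) (by norm_num),
        mul_zero]
  | succ N ih =>
    have key := sum_deformedTerm_odd_succ (K := K) N n
    have h0 : deformedTerm ((2 * (N + 1) + 3 / 2) ^ 2 : K) 0 n = 0 :=
      Finset.prod_eq_zero (i := 2 * N + 3) (Finset.mem_range.2 (by omega))
        (by push_cast; ring)
    rw [h0, mul_zero] at key
    simp only [mul_sub, Finset.sum_sub_distrib, mul_left_comm _ (_ * _ : K), ← Finset.mul_sum]
      at key
    rw [← deformedSum, ← deformedSum, ih (by omega), mul_zero, sub_zero] at key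
    simpa using key

/-- The coefficient of the value at `node K N` when a truncated deformed sum is recovered at
`Y = 0` from its values at the nodes. -/
def nodeWeight (K : Type*) [Field K] (n N : ℕ) : K :=
  (∏ j ∈ Finset.range (n - 1), (1 - node K N / (j + 1) ^ 2)) *
    ∏ i ∈ (Finset.range n).erase N, (node K i / (node K i - node K N))

lemma node_sub_node (i N : ℕ) :
    node K i - node K N = 2 * (i - N) * (2 * N + 1 + 2 * i) := by
  simp only [node]; ring

lemma node_injective : Function.Injective (node K) := fun i N h => by
  have := node_sub_node (K := K) i N
  rw [h, sub_self, eq_comm, mul_eq_zero, mul_eq_zero] at this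
  rcases this with (h | h) | h
  · simp at h
  · exact_mod_cast sub_eq_zero.1 h
  · exact absurd h (by exact_mod_cast (by omega : 2 * N + 1 + 2 * i ≠ 0))

omit [CharZero K] in
open Polynomial in
lemma natDegree_prod_sub_C_mul_X_le (a b : ℕ → K) (s : Finset ℕ) :
    (∏ i ∈ s, (C (a i) - C (b i) * X)).natDegree ≤ s.card := by
  refine (natDegree_prod_le _ _).trans ((Finset.sum_le_card_nsmul _ _ 1 fun i _ => ?_).trans
    (by simp))
  compute_degree

open Polynomial in
lemma deformedSum_zero_eq (z : K) (n : ℕ) :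
    deformedSum z 0 n = ∑ N ∈ Finset.range n, nodeWeight K n N * deformedSum z (node K N) n := by
  let c (k : ℕ) : K := (6 * k + 1) * ∏ i ∈ Finset.range k, ((i + 1 / 2) * ((i + 1 / 2) ^ 2 - z) /
    ((i + 1) * ((i + 1) ^ 2 - z / 4) * (i + 1) ^ 2))
  let Q : K[X] := ∑ k ∈ Finset.range n, C (c k) *
    ((∏ i ∈ Finset.range k, (C (((i : K) + 1 / 4) ^ 2) - C (1 / 4) * X)) *
      ∏ j ∈ Finset.Ico k (n - 1), (C 1 - C (1 / ((j : K) + 1) ^ 2) * X))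
  have hQ (Y : K) (hY : ∀ j : ℕ, ((j : K) + 1) ^ 2 ≠ Y) :
      Q.eval Y = (∏ j ∈ Finset.range (n - 1), (1 - Y / (j + 1) ^ 2)) * deformedSum z Y n := by
    simp only [Q, eval_finsetSum, deformedSum, Finset.mul_sum]
    refine Finset.sum_congr rfl fun k hk => ?_
    have hk' : k ≤ n - 1 := by simp at hk; omega
    simp only [eval_mul, eval_C, eval_prod, eval_sub, eval_X]
    have hprod : (∏ i ∈ Finset.range k, ((i + 1 / 2) * ((i + 1 / 2) ^ 2 - z) /
          ((i + 1) * ((i + 1) ^ 2 - z / 4) * ((i : K) + 1) ^ 2))) *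
        (∏ i ∈ Finset.range k, (((i : K) + 1 / 4) ^ 2 - 1 / 4 * Y)) =
        (∏ j ∈ Finset.range k, (1 - Y / ((j : K) + 1) ^ 2)) * deformedTerm z Y k := by
      rw [deformedTerm, ← Finset.prod_mul_distrib, ← Finset.prod_mul_distrib]
      refine Finset.prod_congr rfl fun j _ => ?_
      have h1 : (j : K) + 1 ≠ 0 := by exact_mod_cast j.succ_ne_zero
      have h2 := sub_ne_zero.2 (hY j)
      have h3 : 1 - Y / ((j : K) + 1) ^ 2 = (((j : K) + 1) ^ 2 - Y) / (j + 1) ^ 2 := by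
        field_simp
      rw [h3]
      generalize ((j : K) + 1) ^ 2 - Y = W at *
      field_simp
    rw [← Finset.prod_range_mul_prod_Ico _ hk']
    simp only [c, div_mul_eq_mul_div, one_mul] at hprod ⊢
    linear_combination (6 * (k : K) + 1) *
      (∏ j ∈ Finset.Ico k (n - 1), (1 - Y / ((j : K) + 1) ^ 2)) * hprod
  have hdeg : Q.degree < (Finset.range n).card := by
    rw [Finset.card_range]
    refine (degree_sum_le _ _).trans_lt ?_
    rw [Finset.sup_lt_iff (by simp)]
    intro k hk
    rw [Finset.mem_range] at hk
    refine degree_le_natDegree.trans_lt (Nat.cast_lt.2 ?_)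
    refine (natDegree_C_mul_le _ _).trans_lt ?_
    refine (natDegree_mul_le_of_le (natDegree_prod_sub_C_mul_X_le _ _ _)
      (natDegree_prod_sub_C_mul_X_le (fun _ => 1) _ _)).trans_lt ?_
    rw [Finset.card_range, Nat.card_Ico]
    omega
  have hnode (N j : ℕ) : ((j : K) + 1) ^ 2 ≠ node K N := fun h => by
    have : (2 * (j + 1) - (4 * N + 1)) * (2 * ((j : K) + 1) + (4 * N + 1)) = 0 := by
      simp only [node] at h; linear_combination 4 * h
    rcases mul_eq_zero.1 this with h | h
    · exact intCast_ne_zero_of_odd (K := K) (m := 2 * (j + 1) - (4 * N + 1)) (by omega)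
        (by exact_mod_cast h)
    · exact absurd h (by exact_mod_cast (by omega : 2 * (j + 1) + (4 * N + 1) ≠ 0))
  have h0 : deformedSum z 0 n = Q.eval 0 := by
    rw [hQ 0 fun j => pow_ne_zero 2 (by exact_mod_cast j.succ_ne_zero)]
    simp
  rw [h0, Lagrange.eq_interpolate (s := Finset.range n) (v := node K) node_injective.injOn hdeg,
    Lagrange.interpolate_apply, eval_finsetSum]
  refine Finset.sum_congr rfl fun N hN => ?_
  rw [eval_mul, eval_C, hQ _ (hnode N), Lagrange.basis, eval_prod, nodeWeight, mul_right_comm]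
  congr 2
  refine Finset.prod_congr rfl fun i hi => ?_
  have hne : node K i - node K N ≠ 0 :=
    sub_ne_zero.2 fun h => Finset.ne_of_mem_erase hi (node_injective h)
  rw [Lagrange.basisDivisor, eval_mul, eval_C, eval_sub, eval_X, eval_C, zero_sub,
    ← neg_sub (node K i), inv_neg, neg_mul_neg, div_eq_mul_inv, mul_comm]

end Identities

section Erase

open Finset

variable {M : Type*} [CommMonoid M]

lemma prod_range_erase (q : ℕ → M) (N m : ℕ) :
    ∏ i ∈ (range (N + 1 + m)).erase N, q i =
      (∏ i ∈ range N, q i) * ∏ j ∈ range m, q (N + 1 + j) := by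
  have h : (range (N + 1 + m)).erase N = range N ∪ Ico (N + 1) (N + 1 + m) := by
    ext; simp only [mem_erase, mem_range, mem_union, mem_Ico]; omega
  have hd : Disjoint (range N) (Ico (N + 1) (N + 1 + m)) := by
    rw [disjoint_left]; intro i; simp only [mem_range, mem_Ico]; omega
  rw [h, prod_union hd, prod_Ico_eq_prod_range, Nat.add_sub_cancel_left]

lemma prod_range_mul_prod_range_eq_prod_erase (h : ℤ → M) {N n : ℕ} (hN : N < n) :
    (∏ j ∈ range (n - 1), h (N + 1 + j)) * ∏ j ∈ range (n - 1), h (N - 1 - j) =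
      (∏ i ∈ (range n).erase N, h i) *
        ∏ i ∈ (range n).erase N, h (if i < N then i + n else i - n) := by
  obtain ⟨m, rfl⟩ := Nat.exists_eq_add_of_le hN
  simp only [Nat.succ_eq_add_one]
  rw [prod_range_erase, prod_range_erase, show N + 1 + m - 1 = m + N by omega, prod_range_add]
  conv_lhs => rw [add_comm m N, prod_range_add]
  have e1 : ∏ j ∈ range N, h (N - 1 - j) = ∏ j ∈ range N, h j := by
    rw [← prod_range_reflect]
    refine prod_congr rfl fun j hj => ?_
    rw [mem_range] at hj
    congr 1; omega
  have e2 : ∏ j ∈ range m, h (N - 1 - (N + j : ℕ)) =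
      ∏ j ∈ range m, h (if N + 1 + j < N then (N + 1 + j : ℕ) + (N + 1 + m : ℕ)
        else (N + 1 + j : ℕ) - (N + 1 + m : ℕ)) := by
    rw [← prod_range_reflect]
    refine prod_congr rfl fun j hj => ?_
    rw [mem_range] at hj
    rw [if_neg (by omega)]
    congr 1; omega
  have e3 : ∏ j ∈ range N, h (N + 1 + (m + j : ℕ)) =
      ∏ j ∈ range N, h (if j < N then (j : ℤ) + (N + 1 + m : ℕ) else j - (N + 1 + m : ℕ)) := by
    refine prod_congr rfl fun j hj => ?_
    rw [mem_range] at hj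
    rw [if_pos hj]
    congr 1; push_cast; ring
  rw [e1, e2, e3]
  push_cast
  simp only [mul_assoc, mul_left_comm]

end Erase

section Residues

open Finset

variable (p : ℕ) [hp : Fact p.Prime] (r : ℕ)

/-- The largest `p`-adic norm of an integer that reduces to `u` modulo `p ^ r` and of `p ^ r`. -/
noncomputable def residueNorm (u : ZMod (p ^ r)) : ℝ :=
  max ‖(u.val : ℚ_[p])‖ ‖((p ^ r : ℕ) : ℚ_[p])‖

variable {p r}

lemma norm_natCast_pow : ‖((p ^ r : ℕ) : ℚ_[p])‖ = (p : ℝ) ^ (-r : ℤ) := by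
  push_cast
  rw [norm_pow, Padic.norm_p, zpow_neg, zpow_natCast, inv_pow]

lemma residueNorm_intCast (x : ℤ) :
    residueNorm p r x = max ‖(x : ℚ_[p])‖ ‖((p ^ r : ℕ) : ℚ_[p])‖ := by
  have : NeZero (p ^ r) := ⟨pow_ne_zero _ hp.out.ne_zero⟩
  have h := ZMod.val_intCast (n := p ^ r) x
  have hx : (x : ℚ_[p]) = ((x : ZMod (p ^ r)).val : ℚ_[p]) +
      ((p ^ r : ℕ) : ℚ_[p]) * ((x / (p ^ r : ℕ) : ℤ) : ℚ_[p]) := by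
    rw [← Int.cast_natCast (ZMod.val _), h]
    exact_mod_cast (Int.emod_add_mul_ediv x (p ^ r : ℕ)).symm
  have hq : ‖((p ^ r : ℕ) : ℚ_[p]) * ((x / (p ^ r : ℕ) : ℤ) : ℚ_[p])‖ ≤
      ‖((p ^ r : ℕ) : ℚ_[p])‖ := by
    rw [norm_mul]
    exact mul_le_of_le_one_right (norm_nonneg _) (Padic.norm_int_le_one _)
  refine le_antisymm (max_le ?_ (le_max_right _ _)) (max_le ?_ (le_max_right _ _))
  · rw [eq_sub_of_add_eq hx.symm, sub_eq_add_neg]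
    refine (Padic.nonarchimedean _ _).trans (max_le_max le_rfl ?_)
    rwa [norm_neg]
  · rw [hx]
    exact (Padic.nonarchimedean _ _).trans (max_le_max le_rfl hq)

lemma norm_le_residueNorm (x : ℤ) : ‖(x : ℚ_[p])‖ ≤ residueNorm p r x := by
  rw [residueNorm_intCast]
  exact le_max_left _ _

lemma residueNorm_pos (u : ZMod (p ^ r)) : 0 < residueNorm p r u :=
  lt_max_of_lt_right (norm_pos_iff.2 (Nat.cast_ne_zero.2 (pow_ne_zero _ hp.out.ne_zero)))

lemma norm_eq_residueNorm {x : ℤ} (hx : x ≠ 0) (h : |x| < (p ^ r : ℕ)) :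
    ‖(x : ℚ_[p])‖ = residueNorm p r x := by
  rw [residueNorm_intCast, eq_comm, max_eq_left_iff, norm_natCast_pow]
  by_contra hlt
  have hd := (Padic.norm_int_le_pow_iff_dvd x r).1 (not_le.1 hlt).le
  exact absurd (Int.le_of_dvd (abs_pos.2 hx) ((dvd_abs _ _).2 hd)) (by push_cast at h; omega)

lemma prod_residueNorm_affine {a : ℤ} (ha : IsCoprime a p) (b : ℤ) :
    ∏ i ∈ range (p ^ r), residueNorm p r (a * i + b : ℤ) =
      ∏ i ∈ range (p ^ r), residueNorm p r (i : ℤ) := by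
  have : NeZero (p ^ r) := ⟨pow_ne_zero _ hp.out.ne_zero⟩
  have hu : IsUnit ((a : ℤ) : ZMod (p ^ r)) := by
    rw [ZMod.coe_int_isUnit_iff_isCoprime]
    push_cast
    exact ha.symm.pow_left
  have key (f : ZMod (p ^ r) → ℝ) : ∏ i ∈ range (p ^ r), f i = ∏ u, f u := by
    refine prod_bij' (fun i _ => (i : ZMod (p ^ r))) (fun u _ => u.val) (by simp)
      (fun u _ => mem_range.2 u.val_lt)
      (fun i hi => ZMod.val_cast_of_lt (mem_range.1 hi)) (fun u _ => by simp) (by simp)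
  push_cast
  rw [key, key fun u => residueNorm p r (a * u + b)]
  let e : ZMod (p ^ r) ≃ ZMod (p ^ r) := (Units.mulLeft hu.unit).trans (Equiv.addRight b)
  exact Fintype.prod_equiv e _ _ fun u => rfl

/-- The norm of `(p ^ r - 1)!`. -/
lemma prod_residueNorm :
    ∏ i ∈ range (p ^ r), residueNorm p r (i : ℤ) =
      (∏ j ∈ range (p ^ r - 1), ‖(j + 1 : ℚ_[p])‖) * ‖((p ^ r : ℕ) : ℚ_[p])‖ := by
  obtain ⟨m, hm⟩ := Nat.exists_eq_succ_of_ne_zero (pow_ne_zero r hp.out.ne_zero)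
  rw [show range (p ^ r) = range (p ^ r - 1 + 1) by rw [hm]; rfl, prod_range_succ']
  congr 1
  · refine prod_congr rfl fun j hj => ?_
    rw [mem_range] at hj
    rw [← norm_eq_residueNorm (by omega)]
    · push_cast; rfl
    · rw [abs_of_nonneg (by omega)]; omega
  · rw [residueNorm_intCast]; simp

lemma prod_erase_residueNorm {a : ℤ} (ha : IsCoprime a p) (b : ℤ) {N : ℕ} (hN : N < p ^ r) :
    ∏ i ∈ (range (p ^ r)).erase N, residueNorm p r (a * i + b : ℤ) =
      (∏ j ∈ range (p ^ r - 1), ‖(j + 1 : ℚ_[p])‖) * ‖((p ^ r : ℕ) : ℚ_[p])‖ /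
        residueNorm p r (a * N + b : ℤ) := by
  rw [eq_div_iff (residueNorm_pos _).ne', prod_erase_mul _ _ (mem_range.2 hN),
    prod_residueNorm_affine ha, prod_residueNorm]

end Residues

section WeightBound

open Finset

variable {p : ℕ} [hp : Fact p.Prime] {r : ℕ}

lemma norm_natCast_eq_one {m : ℕ} (h : m.Coprime p) : ‖(m : ℚ_[p])‖ = 1 :=
  Padic.norm_natCast_eq_one_iff.2 h.symm

omit hp in
lemma coprime_two_pow (hodd : Odd p) (k : ℕ) : (2 ^ k).Coprime p :=
  (Nat.coprime_two_left.2 hodd).pow_left k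

lemma norm_two (hodd : Odd p) : ‖(2 : ℚ_[p])‖ = 1 := by
  exact_mod_cast norm_natCast_eq_one (coprime_two_pow hodd 1)

lemma norm_four (hodd : Odd p) : ‖(4 : ℚ_[p])‖ = 1 := by
  exact_mod_cast norm_natCast_eq_one (coprime_two_pow hodd 2)

lemma prod_norm_one_sub_node (hodd : Odd p) {n N : ℕ} (hN : N < n) :
    ‖∏ j ∈ range (n - 1), (1 - node ℚ_[p] N / (j + 1) ^ 2)‖ =
      (∏ i ∈ (range n).erase N, ‖(2 * N + 1 + 2 * i : ℚ_[p])‖) *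
        (∏ i ∈ (range n).erase N,
          ‖((2 * N + 1 + 2 * (if i < N then (i : ℤ) + n else i - n) : ℤ) : ℚ_[p])‖) /
        (∏ j ∈ range (n - 1), ‖(j + 1 : ℚ_[p])‖) ^ 2 := by
  have h := prod_range_mul_prod_range_eq_prod_erase
    (fun t => ‖((2 * N + 1 + 2 * t : ℤ) : ℚ_[p])‖) hN
  push_cast at h ⊢
  rw [← h, ← prod_pow, ← prod_mul_distrib, ← prod_div_distrib, norm_prod]
  refine prod_congr rfl fun j _ => ?_
  have h1 : (j : ℚ_[p]) + 1 ≠ 0 := by exact_mod_cast j.succ_ne_zero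
  have e : 1 - node ℚ_[p] N / (j + 1) ^ 2 =
      -((2 * N + 1 + 2 * (N + 1 + j)) * (2 * N + 1 + 2 * (N - 1 - j)) / (4 * (j + 1) ^ 2)) := by
    simp only [node]; field_simp; ring
  rw [e, norm_neg, norm_div, norm_mul, norm_mul, norm_four hodd, one_mul, norm_pow]

lemma prod_erase_norm_sub {N : ℕ} (hN : N < p ^ r) :
    ∏ i ∈ (range (p ^ r)).erase N, ‖(i - N : ℚ_[p])‖ =
      ∏ j ∈ range (p ^ r - 1), ‖(j + 1 : ℚ_[p])‖ := by
  have hQ0 : ‖((p ^ r : ℕ) : ℚ_[p])‖ ≠ 0 :=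
    norm_ne_zero_iff.2 (Nat.cast_ne_zero.2 (pow_ne_zero _ hp.out.ne_zero))
  have h := prod_erase_residueNorm (p := p) (r := r) isCoprime_one_left (-N) hN
  rw [residueNorm_intCast (1 * N + -N : ℤ), one_mul, add_neg_cancel, Int.cast_zero, norm_zero,
    max_eq_right (norm_nonneg _), mul_div_cancel_right₀ _ hQ0] at h
  rw [← h]
  refine prod_congr rfl fun i hi => ?_
  rw [mem_erase, mem_range] at hi
  rw [← norm_eq_residueNorm (by omega) (by rw [abs_lt]; omega), one_mul, ← sub_eq_add_neg]
  push_cast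
  rfl

lemma prod_erase_norm_le {a : ℤ} (ha : IsCoprime a p) (b : ℤ) {N : ℕ} (hN : N < p ^ r)
    {f : ℕ → ℤ} (hf : ∀ i, (f i : ZMod (p ^ r)) = (a * i + b : ℤ)) :
    ∏ i ∈ (range (p ^ r)).erase N, ‖(f i : ℚ_[p])‖ ≤
      (∏ j ∈ range (p ^ r - 1), ‖(j + 1 : ℚ_[p])‖) * ‖((p ^ r : ℕ) : ℚ_[p])‖ /
        residueNorm p r (a * N + b : ℤ) := by
  rw [← prod_erase_residueNorm ha b hN]
  refine prod_le_prod (fun _ _ => norm_nonneg _) fun i _ => ?_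
  exact (norm_le_residueNorm (f i)).trans_eq (congrArg _ (hf i))

lemma norm_nodeWeight_le (hodd : Odd p) {N : ℕ} (hN : N < p ^ r) :
    ‖nodeWeight ℚ_[p] (p ^ r) N‖ ≤
      (‖((p ^ r : ℕ) : ℚ_[p])‖ / residueNorm p r (4 * N + 1 : ℤ)) ^ 3 := by
  have c2 : IsCoprime (2 : ℤ) p := by
    exact_mod_cast Nat.isCoprime_iff_coprime.2 (coprime_two_pow hodd 1)
  have c4 : IsCoprime (4 : ℤ) p := by
    exact_mod_cast Nat.isCoprime_iff_coprime.2 (coprime_two_pow hodd 2)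
  have h4 := prod_erase_norm_le c4 1 hN (f := fun i => 4 * i + 1) (fun i => by rfl)
  have h2 := prod_erase_norm_le c2 (2 * N + 1) hN
    (f := fun i => 2 * N + 1 + 2 * (if i < N then (i : ℤ) + (p ^ r : ℕ) else i - (p ^ r : ℕ)))
    (fun i => by
      have hn : (p : ZMod (p ^ r)) ^ r = 0 := by exact_mod_cast ZMod.natCast_self (p ^ r)
      split_ifs <;> push_cast <;> rw [hn] <;> ring)
  rw [show (2 : ℤ) * N + (2 * N + 1) = 4 * N + 1 by ring] at h2
  have hE0 : 0 < ∏ j ∈ range (p ^ r - 1), ‖(j + 1 : ℚ_[p])‖ :=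
    prod_pos fun j _ => norm_pos_iff.2 (by exact_mod_cast j.succ_ne_zero)
  have hf0 : ∏ i ∈ (range (p ^ r)).erase N, ‖(2 * N + 1 + 2 * i : ℚ_[p])‖ ≠ 0 :=
    prod_ne_zero_iff.2 fun i _ =>
      norm_ne_zero_iff.2 (by exact_mod_cast (by omega : 2 * N + 1 + 2 * i ≠ 0))
  have hd : ∏ i ∈ (range (p ^ r)).erase N, ‖node ℚ_[p] i / (node ℚ_[p] i - node ℚ_[p] N)‖ =
      (∏ i ∈ (range (p ^ r)).erase N, ‖((4 * i + 1 : ℤ) : ℚ_[p])‖) ^ 2 /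
        ((∏ j ∈ range (p ^ r - 1), ‖(j + 1 : ℚ_[p])‖) *
          ∏ i ∈ (range (p ^ r)).erase N, ‖(2 * N + 1 + 2 * i : ℚ_[p])‖) := by
    rw [← prod_erase_norm_sub hN, ← prod_pow, ← prod_mul_distrib, ← prod_div_distrib]
    refine prod_congr rfl fun i _ => ?_
    have e : node ℚ_[p] i = ((4 * i + 1 : ℤ) : ℚ_[p]) ^ 2 / 4 := by
      simp only [node]; push_cast; ring
    rw [node_sub_node, e, norm_div, norm_div, norm_mul, norm_mul, norm_pow, norm_four hodd,
      norm_two hodd, div_one, one_mul]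
  have hG := residueNorm_pos (p := p) (r := r) (4 * N + 1 : ℤ)
  rw [nodeWeight, norm_mul, prod_norm_one_sub_node hodd hN, norm_prod, hd]
  generalize ∏ i ∈ (range (p ^ r)).erase N, ‖(2 * N + 1 + 2 * i : ℚ_[p])‖ = A at *
  generalize ∏ j ∈ range (p ^ r - 1), ‖(j + 1 : ℚ_[p])‖ = E at *
  generalize ‖((p ^ r : ℕ) : ℚ_[p])‖ = Q at *
  generalize residueNorm p r (4 * N + 1 : ℤ) = G at *
  have hC0 : 0 ≤ ∏ i ∈ (range (p ^ r)).erase N, ‖((4 * i + 1 : ℤ) : ℚ_[p])‖ :=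
    prod_nonneg fun _ _ => norm_nonneg _
  have hB0 : 0 ≤ ∏ i ∈ (range (p ^ r)).erase N, ‖((2 * N + 1 + 2 *
      (if i < N then (i : ℤ) + (p ^ r : ℕ) else i - (p ^ r : ℕ)) : ℤ) : ℚ_[p])‖ :=
    prod_nonneg fun _ _ => norm_nonneg _
  generalize ∏ i ∈ (range (p ^ r)).erase N, ‖((4 * i + 1 : ℤ) : ℚ_[p])‖ = C at *
  generalize ∏ i ∈ (range (p ^ r)).erase N, ‖((2 * N + 1 + 2 *
      (if i < N then (i : ℤ) + (p ^ r : ℕ) else i - (p ^ r : ℕ)) : ℤ) : ℚ_[p])‖ = B at *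
  calc A * B / E ^ 2 * (C ^ 2 / (E * A)) = B * C ^ 2 / E ^ 3 := by field_simp
    _ ≤ (E * Q / G) * (E * Q / G) ^ 2 / E ^ 3 := by
      gcongr
      exact hC0.trans h4
    _ = (Q / G) ^ 3 := by field_simp

end WeightBound

section CentralBinom

open Finset

variable {p : ℕ} [hp : Fact p.Prime] {r : ℕ}

lemma nodeValue_zero {K : Type*} [Field K] [CharZero K] (N : ℕ) :
    nodeValue (0 : K) N = (4 * N + 1) * (N.centralBinom / 4 ^ N) ^ 2 := by
  rw [nodeValue]
  congr 1
  induction N with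
  | zero => simp
  | succ N ih =>
    have h1 : (N : K) + 1 ≠ 0 := by exact_mod_cast N.succ_ne_zero
    have h := congrArg (Nat.cast (R := K)) (Nat.succ_mul_centralBinom_succ N)
    push_cast at h
    rw [prod_range_succ, ih, eq_div_of_mul_eq h1 ((mul_comm _ _).trans h), pow_succ]
    field_simp
    ring

/-- The base `p` addition `N + N` carries out of position `i - 1` when `p ^ i ∣ 4 * N + 1`. -/
lemma pow_card_dvd_centralBinom (hp4 : p % 4 = 3) {N : ℕ} {T : Finset ℕ}
    (hT : ∀ i ∈ T, Odd i ∧ p ^ i ∣ 4 * N + 1) : p ^ T.card ∣ N.centralBinom := by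
  rw [padicValNat_dvd_iff_le N.centralBinom_ne_zero, Nat.centralBinom,
    padicValNat_choose (b := Nat.log p (2 * N) + T.sup id + 1) (by omega) (by omega)]
  refine card_le_card fun i hi => ?_
  obtain ⟨hodd, hdvd⟩ := hT i hi
  have hle : i ≤ T.sup id := le_sup (f := id) hi
  have hpos := hodd.pos
  rw [mem_filter, mem_Ico]
  refine ⟨by omega, ?_⟩
  have h3 : p ^ i % 4 = 3 := by
    obtain ⟨m, rfl⟩ := hodd
    rw [pow_succ, pow_mul, Nat.mul_mod, Nat.pow_mod, Nat.pow_mod p, hp4]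
    simp
  rw [two_mul, Nat.add_sub_cancel]
  have hm : p ^ i ∣ 4 * (N % p ^ i) + 1 := by
    have h := ((Nat.mod_modEq N (p ^ i)).mul_left 4).add_right 1
    exact (h.dvd_iff dvd_rfl).2 hdvd
  have hlt : N % p ^ i < p ^ i := Nat.mod_lt _ (pow_pos hp.out.pos i)
  obtain ⟨c, hc⟩ := hm
  have hc4 : c < 4 := by
    by_contra! h
    have := Nat.mul_le_mul_left (p ^ i) h
    omega
  interval_cases c <;> omega

lemma norm_centralBinom_le (hp4 : p % 4 = 3) {N : ℕ} {T : Finset ℕ}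
    (hT : ∀ i ∈ T, Odd i ∧ p ^ i ∣ 4 * N + 1) :
    ‖(N.centralBinom : ℚ_[p])‖ ≤ (p : ℝ) ^ (-T.card : ℤ) := by
  have h := (Padic.norm_int_le_pow_iff_dvd (p := p) N.centralBinom T.card).2
    (by exact_mod_cast pow_card_dvd_centralBinom hp4 hT)
  exact_mod_cast h

lemma norm_nodeValue_zero (hodd : Odd p) (N : ℕ) :
    ‖nodeValue (0 : ℚ_[p]) N‖ = ‖((4 * N + 1 : ℕ) : ℚ_[p])‖ * ‖(N.centralBinom : ℚ_[p])‖ ^ 2 := by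
  rw [nodeValue_zero, norm_mul, norm_pow, norm_div, norm_pow, norm_four hodd, one_pow, div_one]
  push_cast
  rfl

lemma norm_nodeValue_zero_le (hp4 : p % 4 = 3) (hr : 3 ≤ r) {N : ℕ} (hN : p ^ r ∣ 4 * N + 1) :
    ‖nodeValue (0 : ℚ_[p]) N‖ ≤ (p : ℝ) ^ (-(r + 4) : ℤ) := by
  have hp0 : (p : ℝ) ≠ 0 := Nat.cast_ne_zero.2 hp.out.ne_zero
  have h1 := norm_centralBinom_le (p := p) hp4 (N := N) (T := {1, 3}) fun i hi => by
    rw [mem_insert, mem_singleton] at hi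
    rcases hi with rfl | rfl
    · exact ⟨by decide, (pow_dvd_pow p (by omega)).trans hN⟩
    · exact ⟨by decide, (pow_dvd_pow p hr).trans hN⟩
  have h2 := (Padic.norm_int_le_pow_iff_dvd (p := p) (4 * N + 1 : ℕ) r).2 (by exact_mod_cast hN)
  rw [norm_nodeValue_zero (hp.out.odd_of_ne_two (by rintro rfl; omega))]
  calc _ ≤ (p : ℝ) ^ (-r : ℤ) * ((p : ℝ) ^ (-2 : ℤ)) ^ 2 := by
        gcongr
        · exact_mod_cast h2
        · simpa using h1
    _ = (p : ℝ) ^ (-(r + 4) : ℤ) := by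
      rw [← zpow_natCast, ← zpow_mul, ← zpow_add₀ hp0]; congr 1; push_cast; ring

lemma norm_nodeWeight_mul_nodeValue_le (hp4 : p % 4 = 3) (hr : 3 ≤ r) {N : ℕ} (hN : N < p ^ r) :
    ‖nodeWeight ℚ_[p] (p ^ r) N * nodeValue 0 N‖ ≤ (p : ℝ) ^ (-(r + 4) : ℤ) := by
  have hodd : Odd p := hp.out.odd_of_ne_two (by rintro rfl; omega)
  have hp0 : (p : ℝ) ≠ 0 := Nat.cast_ne_zero.2 hp.out.ne_zero
  have hp1 : (1 : ℝ) ≤ p := by exact_mod_cast hp.out.one_le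
  have hw := norm_nodeWeight_le hodd hN
  have hG := residueNorm_intCast (p := p) (r := r) (4 * N + 1)
  have hG0 := residueNorm_pos (p := p) (r := r) (4 * N + 1 : ℤ)
  rw [norm_mul]
  by_cases hd : p ^ r ∣ 4 * N + 1
  · have hQ : ‖((p ^ r : ℕ) : ℚ_[p])‖ / residueNorm p r (4 * N + 1 : ℤ) ≤ 1 := by
      rw [div_le_one hG0, hG]
      exact le_max_right _ _
    exact (mul_le_of_le_one_left (norm_nonneg _) (hw.trans (pow_le_one₀ (by positivity) hQ))).trans
      (norm_nodeValue_zero_le hp4 hr hd)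
  · obtain ⟨s, m, hm, hc⟩ :=
      Nat.exists_eq_pow_mul_and_not_dvd (show 4 * N + 1 ≠ 0 by omega) p hp.out.ne_one
    have hs : s < r := by
      by_contra! h
      exact hd (hc ▸ (pow_dvd_pow p h).mul_right m)
    have hcn : ‖((4 * N + 1 : ℕ) : ℚ_[p])‖ = (p : ℝ) ^ (-s : ℤ) := by
      rw [hc, Nat.cast_mul, norm_mul, norm_natCast_pow,
        norm_natCast_eq_one ((hp.out.coprime_iff_not_dvd.2 hm).symm), mul_one]
    have hw' : ‖nodeWeight ℚ_[p] (p ^ r) N‖ ≤ (p : ℝ) ^ (-(3 * (r - s)) : ℤ) := by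
      refine hw.trans ?_
      have : (p : ℝ) ^ (-s : ℤ) ≤ residueNorm p r (4 * N + 1 : ℤ) := by
        rw [← hcn]
        exact_mod_cast norm_le_residueNorm (p := p) (r := r) (4 * N + 1)
      rw [norm_natCast_pow]
      calc _ ≤ ((p : ℝ) ^ (-r : ℤ) / (p : ℝ) ^ (-s : ℤ)) ^ 3 := by gcongr
        _ = _ := by
          rw [← zpow_sub₀ hp0, ← zpow_natCast, ← zpow_mul]; congr 1; push_cast; ring
    rw [norm_nodeValue_zero hodd, hcn]
    rcases Nat.eq_zero_or_pos s with rfl | hs0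
    · calc _ ≤ (p : ℝ) ^ (-(3 * (r - (0 : ℕ))) : ℤ) * ((p : ℝ) ^ (-(0 : ℕ) : ℤ) * 1 ^ 2) := by
            gcongr
            exact_mod_cast Padic.norm_int_le_one _
        _ = (p : ℝ) ^ (-(3 * r) : ℤ) := by simp
        _ ≤ _ := zpow_le_zpow_right₀ hp1 (by omega)
    · have hb := norm_centralBinom_le (p := p) hp4 (N := N) (T := {1}) fun i hi => by
        rw [mem_singleton] at hi
        exact ⟨by rw [hi]; decide, hc ▸ (pow_dvd_pow p (by omega)).mul_right m⟩
      calc _ ≤ (p : ℝ) ^ (-(3 * (r - s)) : ℤ) * ((p : ℝ) ^ (-s : ℤ) * ((p : ℝ) ^ (-1 : ℤ)) ^ 2) := by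
            gcongr
            simpa using hb
        _ = (p : ℝ) ^ (-(3 * r - 2 * s + 2) : ℤ) := by
          rw [← zpow_natCast, ← zpow_mul, ← zpow_add₀ hp0, ← zpow_add₀ hp0]
          congr 1; push_cast; ring
        _ ≤ _ := zpow_le_zpow_right₀ hp1 (by omega)

lemma norm_deformedSum_sub_le_of_three_le (hp4 : p % 4 = 3) (hr : 3 ≤ r) {N₀ : ℕ}
    (hN₀ : 4 * N₀ + 1 = 3 * p ^ r) :
    ‖deformedSum (0 : ℚ_[p]) 0 (p ^ r) - nodeValue 0 N₀ / 4‖ ≤ (p : ℝ) ^ (-(r + 4) : ℤ) := by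
  have hodd : Odd p := hp.out.odd_of_ne_two (by rintro rfl; omega)
  rw [sub_eq_add_neg]
  refine (Padic.nonarchimedean _ _).trans (max_le ?_ ?_)
  · rw [deformedSum_zero_eq]
    refine IsUltrametricDist.norm_sum_le_of_forall_le_of_nonneg (by positivity) fun N hN => ?_
    rw [mem_range] at hN
    rw [deformedSum_node _ (fun i => ?_) hN]
    · exact norm_nodeWeight_mul_nodeValue_le hp4 hr hN
    · rw [zero_div, sub_zero]
      exact pow_ne_zero 2 (by exact_mod_cast i.succ_ne_zero)
  · rw [norm_neg, norm_div, norm_four hodd, div_one]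
    exact norm_nodeValue_zero_le hp4 hr (hN₀ ▸ dvd_mul_left _ _)

end CentralBinom

section PrimeCase

open Finset

variable {p : ℕ} [hp : Fact p.Prime] {ε : ℝ}

lemma norm_mul_sub_mul_le {a b c d : ℚ_[p]} (ha : ‖a‖ ≤ 1) (hd : ‖d‖ ≤ 1) (hac : ‖a - c‖ ≤ ε)
    (hbd : ‖b - d‖ ≤ ε) : ‖a * b - c * d‖ ≤ ε := by
  rw [show a * b - c * d = a * (b - d) + (a - c) * d by ring]
  refine (Padic.nonarchimedean _ _).trans (max_le ?_ ?_) <;> rw [norm_mul]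
  · exact (mul_le_of_le_one_left (norm_nonneg _) ha).trans hbd
  · exact (mul_le_of_le_one_right (norm_nonneg _) hd).trans hac

lemma norm_prod_sub_prod_le {s : Finset ℕ} {f g : ℕ → ℚ_[p]} (hε : 0 ≤ ε)
    (hf : ∀ i ∈ s, ‖f i‖ ≤ 1) (hg : ∀ i ∈ s, ‖g i‖ ≤ 1) (h : ∀ i ∈ s, ‖f i - g i‖ ≤ ε) :
    ‖∏ i ∈ s, f i - ∏ i ∈ s, g i‖ ≤ ε := by
  induction s using Finset.cons_induction with
  | empty => simpa using hε
  | cons a s ha ih =>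
    simp only [forall_mem_cons] at hf hg h
    rw [prod_cons, prod_cons]
    refine norm_mul_sub_mul_le hf.1 ?_ h.1 (ih hf.2 hg.2 h.2)
    rw [norm_prod]
    exact prod_le_one (fun _ _ => norm_nonneg _) hg.2

lemma norm_sub_eq_one {b t : ℚ_[p]} (hb : ‖b‖ = 1) (ht : ‖t‖ < 1) : ‖b - t‖ = 1 := by
  rw [sub_eq_add_neg, Padic.add_eq_max_of_ne (by rw [norm_neg, hb]; exact ht.ne'), norm_neg, hb,
    max_eq_left ht.le]

lemma norm_div_le_one {a b t : ℚ_[p]} (ha : ‖a‖ ≤ 1) (hb : ‖b‖ = 1) (ht : ‖t‖ < 1) :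
    ‖(a - t) / (b - t)‖ ≤ 1 := by
  rw [norm_div, norm_sub_eq_one hb ht, div_one, sub_eq_add_neg]
  exact (Padic.nonarchimedean _ _).trans (max_le ha (by rw [norm_neg]; exact ht.le))

lemma norm_div_sub_div_le {a b t : ℚ_[p]} (ha : ‖a‖ ≤ 1) (hb : ‖b‖ = 1) (ht : ‖t‖ < 1) :
    ‖a / b - (a - t) / (b - t)‖ ≤ ‖t‖ := by
  have h1 := norm_sub_eq_one hb ht
  have hb0 : b ≠ 0 := norm_ne_zero_iff.1 (by rw [hb]; exact one_ne_zero)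
  have hbt : b - t ≠ 0 := norm_ne_zero_iff.1 (by rw [h1]; exact one_ne_zero)
  rw [show a / b - (a - t) / (b - t) = t * (b - a) / (b * (b - t)) by field_simp; ring,
    norm_div, norm_mul, norm_mul, h1, hb, one_mul, div_one]
  refine mul_le_of_le_one_right (norm_nonneg _) ?_
  rw [sub_eq_add_neg]
  exact (Padic.nonarchimedean _ _).trans (max_le hb.le (by rwa [norm_neg]))

lemma norm_inv_sub_inv_le {b t : ℚ_[p]} (hb : ‖b‖ = 1) (ht : ‖t‖ < 1) :
    ‖b⁻¹ - (b - t)⁻¹‖ ≤ ‖t‖ := by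
  have h1 := norm_sub_eq_one hb ht
  have hb0 : b ≠ 0 := norm_ne_zero_iff.1 (by rw [hb]; exact one_ne_zero)
  have hbt : b - t ≠ 0 := norm_ne_zero_iff.1 (by rw [h1]; exact one_ne_zero)
  rw [inv_sub_inv hb0 hbt, norm_div, norm_mul, h1, hb, mul_one, div_one, sub_sub_cancel_left,
    norm_neg]

lemma norm_add_half_sq_le_one (hodd : Odd p) (i : ℕ) : ‖((i : ℚ_[p]) + 1 / 2) ^ 2‖ ≤ 1 := by
  rw [show (i : ℚ_[p]) + 1 / 2 = (2 * i + 1 : ℤ) / 2 by push_cast; ring, norm_pow, norm_div,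
    norm_two hodd, div_one]
  exact pow_le_one₀ (norm_nonneg _) (Padic.norm_int_le_one _)

lemma norm_add_one_sq {i : ℕ} (hi : i + 1 < p) : ‖((i : ℚ_[p]) + 1) ^ 2‖ = 1 := by
  have := norm_natCast_eq_one (p := p) (m := i + 1)
    (Nat.coprime_of_lt_prime i.succ_ne_zero hi hp.out).symm
  rw [norm_pow]
  push_cast at this
  rw [this, one_pow]

lemma norm_prod_ratio_sub_le (hodd : Odd p) {s : Finset ℕ} (hs : ∀ i ∈ s, i + 1 < p) {t : ℚ_[p]}
    (ht : ‖t‖ < 1) :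
    ‖∏ i ∈ s, (((i : ℚ_[p]) + 1 / 2) ^ 2 - 0) / (((i : ℚ_[p]) + 1) ^ 2 - 0) -
      ∏ i ∈ s, (((i : ℚ_[p]) + 1 / 2) ^ 2 - t) / (((i : ℚ_[p]) + 1) ^ 2 - t)‖ ≤ ‖t‖ := by
  refine norm_prod_sub_prod_le (norm_nonneg _) (fun i hi => ?_) (fun i hi => ?_) fun i hi => ?_
  · exact norm_div_le_one (norm_add_half_sq_le_one hodd i) (norm_add_one_sq (hs i hi)) (by simp)
  · exact norm_div_le_one (norm_add_half_sq_le_one hodd i) (norm_add_one_sq (hs i hi)) ht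
  · rw [sub_zero, sub_zero]
    exact norm_div_sub_div_le (norm_add_half_sq_le_one hodd i) (norm_add_one_sq (hs i hi)) ht

lemma norm_nodeValue_sub_le (hodd : Odd p) {N : ℕ} (hN : N < p) {z : ℚ_[p]} (hz : ‖z‖ < 1) :
    ‖nodeValue 0 N - nodeValue z N‖ ≤ ‖z‖ := by
  have h4 : ‖z / 4‖ = ‖z‖ := by rw [norm_div, norm_four hodd, div_one]
  rw [nodeValue, nodeValue, ← mul_sub, norm_mul, zero_div, ← h4]
  refine (mul_le_of_le_one_left (norm_nonneg _) ?_).trans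
    (norm_prod_ratio_sub_le hodd (fun i hi => ?_) (h4 ▸ hz))
  · exact_mod_cast Padic.norm_int_le_one (4 * N + 1)
  · rw [mem_range] at hi; omega

lemma norm_le_one_of_sub_one {x : ℚ_[p]} (hε : ε ≤ 1) (hx : ‖x - 1‖ ≤ ε) : ‖x‖ ≤ 1 := by
  rw [← sub_add_cancel x 1]
  exact (Padic.nonarchimedean _ _).trans (max_le (hx.trans hε) norm_one.le)

lemma norm_prod_sub_one_le {s : Finset ℕ} {f : ℕ → ℚ_[p]} (hε : 0 ≤ ε) (hε1 : ε ≤ 1)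
    (hf : ∀ i ∈ s, ‖f i - 1‖ ≤ ε) : ‖∏ i ∈ s, f i - 1‖ ≤ ε := by
  have h := norm_prod_sub_prod_le (g := fun _ => 1) hε
    (fun i hi => norm_le_one_of_sub_one hε1 (hf i hi)) (fun _ _ => norm_one.le) hf
  rwa [prod_const_one] at h

lemma norm_nodeWeight_sub_one_le {n N : ℕ} (hN : ‖node ℚ_[p] N‖ < 1)
    (h1 : ∀ j < n - 1, ‖((j : ℚ_[p]) + 1) ^ 2‖ = 1) (h2 : ∀ i < n, i ≠ N → ‖node ℚ_[p] i‖ = 1) :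
    ‖nodeWeight ℚ_[p] n N - 1‖ ≤ ‖node ℚ_[p] N‖ := by
  rw [nodeWeight]
  generalize node ℚ_[p] N = ν at *
  have ha : ‖∏ j ∈ range (n - 1), (1 - ν / ((j : ℚ_[p]) + 1) ^ 2) - 1‖ ≤ ‖ν‖ :=
    norm_prod_sub_one_le (norm_nonneg _) hN.le fun j hj => by
      rw [sub_sub_cancel_left, norm_neg, norm_div, h1 j (mem_range.1 hj), div_one]
  have hb : ‖∏ i ∈ (range n).erase N, (node ℚ_[p] i / (node ℚ_[p] i - ν)) - 1‖ ≤ ‖ν‖ :=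
    norm_prod_sub_one_le (norm_nonneg _) hN.le fun i hi => by
      rw [mem_erase, mem_range] at hi
      have hu := norm_sub_eq_one (h2 i hi.2 hi.1) hN
      rw [div_sub_one (norm_ne_zero_iff.1 (by rw [hu]; exact one_ne_zero)), sub_sub_cancel,
        norm_div, hu, div_one]
  have h := norm_mul_sub_mul_le (norm_le_one_of_sub_one hN.le ha) norm_one.le ha hb
  rwa [mul_one] at h

lemma norm_nodeValue_sub_sub_le (hodd : Odd p) {N i₀ : ℕ} (hi₀ : i₀ < N)
    (hp₀ : 2 * i₀ + 1 = p) (hN : 4 * N + 1 = 3 * p) :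
    ‖nodeValue (0 : ℚ_[p]) N - nodeValue ((p : ℚ_[p]) ^ 2 / 4) N - nodeValue 0 N / 4‖ ≤
      ‖(p : ℚ_[p])‖ ^ 5 := by
  set t : ℚ_[p] := (p : ℚ_[p]) ^ 2 / 4 / 4 with ht
  have hpn : ‖(p : ℚ_[p])‖ < 1 := Padic.norm_p_lt_one
  have htn : ‖t‖ = ‖(p : ℚ_[p])‖ ^ 2 := by
    rw [ht, norm_div, norm_div, norm_four hodd, div_one, div_one, norm_pow]
  have ht1 : ‖t‖ < 1 := htn ▸ pow_lt_one₀ (norm_nonneg _) hpn two_ne_zero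
  have hb := norm_add_one_sq (p := p) (i := i₀) (by omega)
  have ha : (i₀ : ℚ_[p]) + 1 / 2 = p / 2 := by
    have h := congrArg (Nat.cast (R := ℚ_[p])) hp₀
    push_cast at h
    linear_combination h / 2
  have hc : 4 * (N : ℚ_[p]) + 1 = 3 * p := by exact_mod_cast congrArg (Nat.cast (R := ℚ_[p])) hN
  have hα := norm_prod_ratio_sub_le hodd (s := (range N).erase i₀) (fun i hi => by
    rw [mem_erase, mem_range] at hi; omega) ht1
  have hα1 : ‖∏ i ∈ (range N).erase i₀,
      (((i : ℚ_[p]) + 1 / 2) ^ 2 - 0) / (((i : ℚ_[p]) + 1) ^ 2 - 0)‖ ≤ 1 := by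
    rw [norm_prod]
    refine prod_le_one (fun _ _ => norm_nonneg _) fun i hi => norm_div_le_one
      (norm_add_half_sq_le_one hodd i) (norm_add_one_sq ?_) (by simp)
    rw [mem_erase, mem_range] at hi; omega
  rw [nodeValue, nodeValue, ← mul_prod_erase _ _ (mem_range.2 hi₀),
    ← mul_prod_erase (range N) (fun i : ℕ => (((i : ℚ_[p]) + 1 / 2) ^ 2 - (p : ℚ_[p]) ^ 2 / 4 / 4) /
      (((i : ℚ_[p]) + 1) ^ 2 - (p : ℚ_[p]) ^ 2 / 4 / 4)) (mem_range.2 hi₀), zero_div, ha, hc]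
  simp only [← ht]
  generalize ∏ i ∈ (range N).erase i₀,
      (((i : ℚ_[p]) + 1 / 2) ^ 2 - 0) / (((i : ℚ_[p]) + 1) ^ 2 - 0) = α at *
  generalize ∏ i ∈ (range N).erase i₀,
      (((i : ℚ_[p]) + 1 / 2) ^ 2 - t) / (((i : ℚ_[p]) + 1) ^ 2 - t) = α' at *
  generalize ((i₀ : ℚ_[p]) + 1) ^ 2 = b at *
  have hi := norm_mul_sub_mul_le hα1 (d := (b - t)⁻¹)
    (by rw [norm_inv, norm_sub_eq_one hb ht1, inv_one]) hα (norm_inv_sub_inv_le hb ht1)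
  rw [show 3 * (p : ℚ_[p]) * ((((p : ℚ_[p]) / 2) ^ 2 - 0) / (b - 0) * α) -
      3 * p * ((((p : ℚ_[p]) / 2) ^ 2 - t) / (b - t) * α') -
      3 * p * ((((p : ℚ_[p]) / 2) ^ 2 - 0) / (b - 0) * α) / 4 =
      9 * p ^ 3 / 4 / 4 * (α * b⁻¹ - α' * (b - t)⁻¹) by rw [ht]; ring]
  rw [norm_mul, norm_div, norm_div, norm_mul, norm_pow, norm_four hodd, div_one, div_one]
  have h9 : ‖(9 : ℚ_[p])‖ ≤ 1 := by exact_mod_cast Padic.norm_int_le_one 9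
  calc _ ≤ 1 * ‖(p : ℚ_[p])‖ ^ 3 * ‖(p : ℚ_[p])‖ ^ 2 := by
        gcongr
        exact hi.trans_eq htn
    _ = _ := by ring

lemma norm_deformedSum_sub_le_of_prime {M : ℕ} (hM : p = 4 * M + 3) :
    ‖deformedSum (0 : ℚ_[p]) 0 p - nodeValue 0 (3 * M + 2) / 4‖ ≤ ‖(p : ℚ_[p])‖ ^ 5 := by
  have hodd : Odd p := ⟨2 * M + 1, by omega⟩
  have hpn : ‖(p : ℚ_[p])‖ < 1 := Padic.norm_p_lt_one
  set N₀ := 3 * M + 2 with hN₀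
  set z : ℚ_[p] := (p : ℚ_[p]) ^ 2 / 4 with hz
  have hzn : ‖z‖ = ‖(p : ℚ_[p])‖ ^ 2 := by rw [hz, norm_div, norm_four hodd, div_one, norm_pow]
  have hz1 : ‖z‖ < 1 := hzn ▸ pow_lt_one₀ (norm_nonneg _) hpn two_ne_zero
  have hz0 : deformedSum z 0 p = 0 := by
    have h : (p : ℚ_[p]) = 4 * M + 3 := by exact_mod_cast congrArg (Nat.cast (R := ℚ_[p])) hM
    rw [hz, h, show (4 * (M : ℚ_[p]) + 3) ^ 2 / 4 = (2 * M + 3 / 2) ^ 2 by ring]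
    exact deformedSum_odd M p (by omega)
  have hne (i : ℕ) : ((i : ℚ_[p]) + 1) ^ 2 - z / 4 ≠ 0 := by
    rw [show ((i : ℚ_[p]) + 1) ^ 2 - z / 4 = (4 * (i + 1) - p) * (4 * (i + 1) + p) / 16 by
      rw [hz]; ring]
    refine div_ne_zero (mul_ne_zero ?_ ?_) (by norm_num)
    · exact_mod_cast intCast_ne_zero_of_odd (K := ℚ_[p]) (m := 4 * (i + 1) - p) (by omega)
    · exact_mod_cast (by omega : 4 * (i + 1) + p ≠ 0)
  have hne0 (i : ℕ) : ((i : ℚ_[p]) + 1) ^ 2 - 0 / 4 ≠ 0 := by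
    rw [zero_div, sub_zero]
    exact pow_ne_zero 2 (by exact_mod_cast i.succ_ne_zero)
  have hcop (i : ℕ) (hi : i < p) (hiN : i ≠ N₀) : ‖((4 * i + 1 : ℕ) : ℚ_[p])‖ = 1 := by
    refine norm_natCast_eq_one ((hp.out.coprime_iff_not_dvd.2 ?_).symm)
    rintro ⟨c, hc⟩
    have : c < 4 := by
      by_contra! h
      have := Nat.mul_le_mul_left p h
      omega
    interval_cases c <;> omega
  have hsum : deformedSum (0 : ℚ_[p]) 0 p =
      ∑ N ∈ range p, nodeWeight ℚ_[p] p N * (nodeValue 0 N - nodeValue z N) := by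
    have h : deformedSum (0 : ℚ_[p]) 0 p = deformedSum 0 0 p - deformedSum z 0 p := by
      rw [hz0, sub_zero]
    rw [h, deformedSum_zero_eq 0 p, deformedSum_zero_eq z p, ← sum_sub_distrib]
    refine sum_congr rfl fun N hN => ?_
    rw [mem_range] at hN
    rw [deformedSum_node _ hne0 hN, deformedSum_node _ hne hN, mul_sub]
  have hmem : N₀ ∈ range p := by rw [mem_range]; omega
  have hmain := norm_nodeValue_sub_sub_le hodd (N := N₀) (i₀ := 2 * M + 1) (by omega)
    (by omega) (by omega)
  have hν : ‖node ℚ_[p] N₀‖ ≤ ‖(p : ℚ_[p])‖ ^ 2 := by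
    have : node ℚ_[p] N₀ = 3 ^ 2 * p ^ 2 / 4 := by
      have h : (4 * N₀ + 1 : ℚ_[p]) = 3 * p := by
        exact_mod_cast congrArg (Nat.cast (R := ℚ_[p])) (by omega : 4 * N₀ + 1 = 3 * p)
      rw [node, show 2 * (N₀ : ℚ_[p]) + 1 / 2 = (4 * N₀ + 1) / 2 by ring, h]
      ring
    rw [this, norm_div, norm_four hodd, div_one, norm_mul, norm_pow _ 2, norm_pow _ 2]
    refine mul_le_of_le_one_left (by positivity) (pow_le_one₀ (norm_nonneg _) ?_)
    exact_mod_cast Padic.norm_int_le_one 3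
  have hw : ‖nodeWeight ℚ_[p] p N₀ - 1‖ ≤ ‖(p : ℚ_[p])‖ ^ 2 := by
    refine (norm_nodeWeight_sub_one_le (hν.trans_lt (hzn ▸ hz1))
      (fun j hj => norm_add_one_sq (by omega)) fun i hi hiN => ?_).trans hν
    have h := hcop i hi hiN
    push_cast at h
    rw [node, show 2 * (i : ℚ_[p]) + 1 / 2 = (4 * i + 1) / 2 by ring, norm_pow, norm_div,
      norm_two hodd, h, div_one, one_pow]
  have hD : ‖nodeValue 0 N₀ - nodeValue z N₀‖ ≤ ‖(p : ℚ_[p])‖ ^ 3 := by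
    have hb := norm_centralBinom_le (p := p) (by omega) (N := N₀) (T := {1}) fun i hi => by
      rw [mem_singleton] at hi
      exact ⟨by rw [hi]; decide, ⟨3, by rw [hi, pow_one]; omega⟩⟩
    rw [card_singleton, Nat.cast_one, zpow_neg_one, ← Padic.norm_p] at hb
    have hV : ‖nodeValue (0 : ℚ_[p]) N₀ / 4‖ ≤ ‖(p : ℚ_[p])‖ ^ 3 := by
      rw [norm_div, norm_four hodd, div_one, norm_nodeValue_zero hodd,
        show 4 * N₀ + 1 = 3 * p by omega, Nat.cast_mul, norm_mul]
      calc _ ≤ 1 * ‖(p : ℚ_[p])‖ * ‖(p : ℚ_[p])‖ ^ 2 := by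
            gcongr
            exact_mod_cast Padic.norm_int_le_one 3
        _ = _ := by ring
    rw [← sub_add_cancel (_ - nodeValue z N₀) (nodeValue 0 N₀ / 4)]
    exact (Padic.nonarchimedean _ _).trans (max_le
      (hmain.trans (pow_le_pow_of_le_one (norm_nonneg _) hpn.le (by norm_num))) hV)
  rw [hsum, ← add_sum_erase _ _ hmem]
  generalize nodeValue (0 : ℚ_[p]) N₀ = V at *
  rw [show ∀ w D s : ℚ_[p], w * D + s - V / 4 = (w - 1) * D + (D - V / 4) + s by
    intros; ring]
  refine (Padic.nonarchimedean _ _).trans (max_le ((Padic.nonarchimedean _ _).trans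
    (max_le ?_ hmain)) (IsUltrametricDist.norm_sum_le_of_forall_le_of_nonneg (by positivity)
      fun N hN => ?_))
  · rw [norm_mul]
    calc _ ≤ ‖(p : ℚ_[p])‖ ^ 2 * ‖(p : ℚ_[p])‖ ^ 3 := by gcongr
      _ = _ := by ring
  · rw [mem_erase, mem_range] at hN
    have hwN := norm_nodeWeight_le (r := 1) hodd (N := N) (by simpa using hN.2)
    simp only [pow_one] at hwN
    have hG : 1 ≤ residueNorm p 1 (4 * N + 1 : ℤ) := by
      rw [← hcop N hN.2 hN.1]
      exact_mod_cast norm_le_residueNorm (p := p) (r := 1) (4 * N + 1)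
    rw [norm_mul]
    calc _ ≤ (‖(p : ℚ_[p])‖ / 1) ^ 3 * ‖z‖ := by
          gcongr
          · exact hwN.trans (by gcongr)
          · exact norm_nodeValue_sub_le hodd hN.2 hz1
      _ = _ := by rw [hzn]; ring

end PrimeCase

section RisingFac

open Finset

variable {K : Type*} [Field K] [CharZero K]

lemma deformedTerm_zero_zero (k : ℕ) :
    deformedTerm (0 : K) 0 k =
      ((risingFac (1 / 2) k ^ 3 * risingFac (1 / 4) k ^ 2 / (k.factorial : ℚ) ^ 5 : ℚ) : K) := by
  rw [deformedTerm, ← prod_range_add_one_eq_factorial, risingFac, risingFac]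
  push_cast
  rw [← prod_pow, ← prod_pow, ← prod_pow, ← prod_mul_distrib, ← prod_div_distrib]
  refine prod_congr rfl fun i _ => ?_
  have h : (i : K) + 1 ≠ 0 := by exact_mod_cast i.succ_ne_zero
  rw [zero_div, sub_zero, sub_zero, sub_zero]
  ring

lemma nodeValue_zero_eq_risingFac (N : ℕ) :
    nodeValue (0 : K) N =
      (((4 * N + 1) * (risingFac (1 / 2) N ^ 2 / risingFac 1 N ^ 2) : ℚ) : K) := by
  rw [nodeValue, risingFac, risingFac]
  push_cast
  rw [← prod_pow, ← prod_pow, ← prod_div_distrib]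
  congr 1
  refine prod_congr rfl fun i _ => ?_
  rw [zero_div, sub_zero, sub_zero]
  ring

end RisingFac

theorem stmt_3 (p : ℕ) [Fact p.Prime] (hodd : Odd p) (r : ℕ) (hr : 0 < r)
    (hp4 : p ^ r % 4 = 3) :
    ‖(((∑ k ∈ Finset.range (p ^ r),
        (6 * k + 1 : ℚ) * risingFac (1/2) k ^ 3 * risingFac (1/4) k ^ 2 /
          (k.factorial : ℚ) ^ 5) -
        (3 * (p : ℚ) ^ r / 4) *
          risingFac (1/2) ((3 * p ^ r - 1) / 4) ^ 2 /
          risingFac 1 ((3 * p ^ r - 1) / 4) ^ 2 : ℚ) : ℚ_[p])‖ ≤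
      (p : ℝ) ^ (-(r + 4 : ℤ)) := by
  have hN : 4 * ((3 * p ^ r - 1) / 4) + 1 = 3 * p ^ r := by omega
  generalize hN₀ : (3 * p ^ r - 1) / 4 = N at hN
  have hpmod : p % 4 = 3 := by
    have h2 := Nat.odd_iff.1 hodd
    have h4 : p % 4 = 1 ∨ p % 4 = 3 := by omega
    refine h4.resolve_left fun h => ?_
    rw [Nat.pow_mod, h, one_pow] at hp4
    omega
  have hr2 : r ≠ 2 := by
    rintro rfl
    rw [Nat.pow_mod, hpmod] at hp4
    omega
  have hcast : (((∑ k ∈ Finset.range (p ^ r),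
        (6 * k + 1 : ℚ) * risingFac (1/2) k ^ 3 * risingFac (1/4) k ^ 2 /
          (k.factorial : ℚ) ^ 5) -
        (3 * (p : ℚ) ^ r / 4) * risingFac (1/2) N ^ 2 / risingFac 1 N ^ 2 : ℚ) : ℚ_[p]) =
      deformedSum 0 0 (p ^ r) - nodeValue 0 N / 4 := by
    have hNq : (4 * N + 1 : ℚ) = 3 * p ^ r := by exact_mod_cast hN
    rw [deformedSum, nodeValue_zero_eq_risingFac, hNq]
    simp only [deformedTerm_zero_zero]
    push_cast
    congr 1
    · exact Finset.sum_congr rfl fun k _ => by ring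
    · ring
  rw [hcast]
  obtain rfl | hr3 : r = 1 ∨ 3 ≤ r := by omega
  · have h := norm_deformedSum_sub_le_of_prime (p := p) (M := p / 4) (by omega)
    rw [Padic.norm_p, show 3 * (p / 4) + 2 = N by rw [pow_one] at hN; omega] at h
    rw [pow_one]
    refine h.trans_eq ?_
    rw [inv_pow, ← zpow_natCast, ← zpow_neg]
    norm_num
  · exact_mod_cast norm_deformedSum_sub_le_of_three_le hpmod hr3 hN
end
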